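/- arXiv:1908.01258 — 4 statements merged into one kernel-verified Lean document; each statement's English description precedes it below -/
import Mathlib

section
/- Every 3-regular graph is 2-reconstructible: if G is a finite 3-regular simple graph on n vertices and H is any finite simple graph on n vertices having the same (n−2)-deck as G, then H is isomorphic to G. -/
open SimpleGraph

/-- Two graphs have the same `k`-deck if there is a bijection between their `k`-element
vertex subsets under which corresponding induced subgraphs are isomorphic. -/
def SameDeck {V W : Type*} [Fintype V] [Fintype W] [DecidableEq V] [DecidableEq W]
    (G : SimpleGraph V) (H : SimpleGraph W) (k : ℕ) : Prop :=
  ∃ e : {s : Finset V // s.card = k} ≃ {s : Finset W // s.card = k},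
    ∀ s : {s : Finset V // s.card = k},
      Nonempty ((G.induce (↑s.1 : Set V)) ≃g (H.induce (↑(e s).1 : Set W)))

namespace CubicReconstruction

open Finset

section Copies

variable {V W : Type*}

/-- The maps `ι → V` that are injective and pull `G` back to a graph with property `Q`. -/
def Copies {ι : Type*} (G : SimpleGraph V) (Q : SimpleGraph ι → Prop) : Set (ι → V) :=
  {q | Function.Injective q ∧ Q (G.comap q)}

theorem ncard_copies_within {ι : Type*} [Finite ι] {G : SimpleGraph V} {H : SimpleGraph W}
    {s : Set V} {t : Set W} (i : G.induce s ≃g H.induce t) (Q : SimpleGraph ι → Prop) :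
    {q ∈ Copies G Q | ∀ x, q x ∈ s}.ncard = {q ∈ Copies H Q | ∀ x, q x ∈ t}.ncard := by
  refine Set.ncard_congr (fun q hq x => (i ⟨q x, hq.2 x⟩ : W)) ?_ ?_ ?_
  · rintro q ⟨⟨hq, hQ⟩, hs⟩
    refine ⟨⟨fun x y hxy => ?_, ?_⟩, fun x => (i ⟨q x, hs x⟩).2⟩
    · have := i.injective (Subtype.ext hxy)
      exact hq (congrArg Subtype.val this)
    · convert hQ using 1
      ext x y
      exact i.map_adj_iff (v := ⟨q x, hs x⟩) (w := ⟨q y, hs y⟩)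
  · intro p q hp hq h
    ext x
    have := i.injective (Subtype.ext (congrFun h x))
    exact congrArg Subtype.val this
  · rintro q ⟨⟨hq, hQ⟩, ht⟩
    refine ⟨fun x => i.symm ⟨q x, ht x⟩, ⟨⟨fun x y hxy => ?_, ?_⟩,
      fun x => (i.symm ⟨q x, ht x⟩).2⟩, ?_⟩
    · have := i.symm.injective (Subtype.ext hxy)
      exact hq (congrArg Subtype.val this)
    · convert hQ using 1
      ext x y
      exact i.symm.map_adj_iff (v := ⟨q x, ht x⟩) (w := ⟨q y, ht y⟩)
    · ext x
      simp

end Copies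

section Deck

variable {V W U : Type*} [Fintype V] [Fintype W] [Fintype U]
  [DecidableEq V] [DecidableEq W] [DecidableEq U]

theorem sameDeck_symm {G : SimpleGraph V} {H : SimpleGraph W} {k : ℕ} (h : SameDeck G H k) :
    SameDeck H G k := by
  obtain ⟨e, he⟩ := h
  refine ⟨e.symm, fun s => ?_⟩
  obtain ⟨i⟩ := he (e.symm s)
  rw [e.apply_symm_apply] at i
  exact ⟨i.symm⟩

theorem sameDeck_trans_iso {G : SimpleGraph V} {H : SimpleGraph W} {H' : SimpleGraph U} {k : ℕ}
    (h : SameDeck G H k) (f : H ≃g H') : SameDeck G H' k := by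
  obtain ⟨e, he⟩ := h
  refine ⟨e.trans (f.toEquiv.finsetCongr.subtypeEquiv (by simp)), fun s => ?_⟩
  obtain ⟨i⟩ := he s
  refine ⟨i.trans (f.induce ⟨?_, f.injective.injOn, ?_⟩)⟩
  · intro x hx
    simpa using hx
  · intro x hx
    refine ⟨f.symm x, ?_, by simp⟩
    simp only [Equiv.trans_apply, Equiv.subtypeEquiv_apply, Equiv.finsetCongr_apply,
      Finset.coe_map, Set.mem_image] at hx
    obtain ⟨y, hy, rfl⟩ := hx
    simpa using hy

open Classical in
theorem sum_ncard_copies_within {ι : Type*} [Fintype ι] (G : SimpleGraph V)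
    (Q : SimpleGraph ι → Prop) {k : ℕ} (hk : Fintype.card ι ≤ k) :
    ∑ s : {s : Finset V // s.card = k}, {q ∈ Copies G Q | ∀ x, q x ∈ (s.1 : Set V)}.ncard =
      (Copies G Q).ncard *
        (Fintype.card V - Fintype.card ι).choose (k - Fintype.card ι) := by
  have key : ∀ s : Finset V, {q ∈ Copies G Q | ∀ x, q x ∈ (s : Set V)}.ncard =
      #{q ∈ (Copies G Q).toFinset | univ.image q ⊆ s} := by
    intro s
    rw [← Set.ncard_coe_finset]
    congr 1
    ext q
    simp [Finset.image_subset_iff]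
  have h1 : ∑ s : {s : Finset V // s.card = k},
      {q ∈ Copies G Q | ∀ x, q x ∈ (s.1 : Set V)}.ncard =
      ∑ s ∈ powersetCard k (univ : Finset V),
        #{q ∈ (Copies G Q).toFinset | univ.image q ⊆ s} := by
    rw [Finset.sum_subtype (p := fun s : Finset V => s.card = k) _ (by simp)]
    exact Finset.sum_congr rfl fun s _ => key s.1
  rw [h1]
  simp_rw [Finset.card_filter]
  rw [Finset.sum_comm]
  simp_rw [← Finset.card_filter]
  rw [Finset.sum_congr rfl (g := fun _ =>
    (Fintype.card V - Fintype.card ι).choose (k - Fintype.card ι))]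
  · rw [Finset.sum_const, smul_eq_mul, Set.ncard_eq_toFinset_card']
  · intro q hq
    have hq : Function.Injective q := (Set.mem_toFinset.1 hq).1
    have hc : #(univ.image q) = Fintype.card ι := by
      rw [Finset.card_image_of_injective _ hq, Finset.card_univ]
    rw [Finset.card_filter_powersetCard_subset _ _ _ (Finset.subset_univ _) (by rw [hc]; exact hk),
      hc, Finset.card_univ]

/-- Kelly's lemma: graphs with the same `k`-deck contain equally many copies of every pattern
on at most `k` vertices. -/
theorem ncard_copies_eq {ι : Type*} [Fintype ι] {G : SimpleGraph V} {H : SimpleGraph W} {k : ℕ}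
    (hc : Fintype.card W = Fintype.card V) (hkn : k ≤ Fintype.card V)
    (hd : SameDeck G H k) (hk : Fintype.card ι ≤ k) (Q : SimpleGraph ι → Prop) :
    (Copies G Q).ncard = (Copies H Q).ncard := by
  have h1 := sum_ncard_copies_within G Q hk
  have h2 := sum_ncard_copies_within H Q hk
  obtain ⟨e, he⟩ := hd
  have h3 : ∑ s : {s : Finset V // s.card = k},
      {q ∈ Copies G Q | ∀ x, q x ∈ (s.1 : Set V)}.ncard =
      ∑ s : {s : Finset W // s.card = k},
      {q ∈ Copies H Q | ∀ x, q x ∈ (s.1 : Set W)}.ncard := by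
    refine Fintype.sum_equiv e _ _ fun s => ?_
    obtain ⟨i⟩ := he s
    exact ncard_copies_within i Q
  rw [h1, h2, hc] at h3
  refine Nat.eq_of_mul_eq_mul_right (Nat.choose_pos ?_) h3
  omega

theorem exists_agree_off_pair {X Y : SimpleGraph V} (hd : SameDeck X Y (Fintype.card V - 2))
    {u v : V} (huv : u ≠ v) :
    ∃ Y' : SimpleGraph V, Nonempty (Y' ≃g Y) ∧
      ∀ x y, x ≠ u → x ≠ v → y ≠ u → y ≠ v → (Y'.Adj x y ↔ X.Adj x y) := by
  obtain ⟨e, he⟩ := hd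
  have hs : #(univ \ {u, v} : Finset V) = Fintype.card V - 2 := by
    rw [Finset.card_sdiff_of_subset (Finset.subset_univ _), Finset.card_pair huv, Finset.card_univ]
  obtain ⟨i⟩ := he ⟨_, hs⟩
  set t := e ⟨_, hs⟩ with ht
  let f : {x // x ∈ (univ \ {u, v} : Finset V)} ≃ {x // x ∈ t.1} := i.toEquiv
  let ψ := f.extendSubtype
  refine ⟨Y.comap ψ, ⟨SimpleGraph.Iso.comap ψ Y⟩, fun x y h1 h2 h3 h4 => ?_⟩
  have hx : x ∈ (univ \ {u, v} : Finset V) := by simp [h1, h2]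
  have hy : y ∈ (univ \ {u, v} : Finset V) := by simp [h3, h4]
  have ex : ψ x = f ⟨x, hx⟩ := f.extendSubtype_apply_of_mem x hx
  have ey : ψ y = f ⟨y, hy⟩ := f.extendSubtype_apply_of_mem y hy
  rw [SimpleGraph.comap_adj, ex, ey]
  exact i.map_adj_iff (v := ⟨x, hx⟩) (w := ⟨y, hy⟩)

end Deck

section Cubic

variable {V : Type*}

def Cubic (X : SimpleGraph V) : Prop := ∀ v, (X.neighborSet v).ncard = 3

/-- The adjacency indicator. -/
noncomputable def ind (X : SimpleGraph V) (x y : V) : ℤ :=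
  open Classical in if X.Adj x y then 1 else 0

theorem ind_of_adj {X : SimpleGraph V} {x y : V} (h : X.Adj x y) : ind X x y = 1 := by
  simp [ind, h]

theorem ind_of_not_adj {X : SimpleGraph V} {x y : V} (h : ¬ X.Adj x y) : ind X x y = 0 := by
  simp [ind, h]

theorem ind_cases (X : SimpleGraph V) (x y : V) :
    X.Adj x y ∧ ind X x y = 1 ∨ ¬ X.Adj x y ∧ ind X x y = 0 := by
  by_cases h : X.Adj x y <;> simp [ind, h]

theorem ind_comm (X : SimpleGraph V) (x y : V) : ind X x y = ind X y x :=
  open Classical in if_congr (X.adj_comm x y) rfl rfl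

theorem adj_iff_of_ind_eq {X Y : SimpleGraph V} {x y x' y' : V} (h : ind X x y = ind Y x' y') :
    X.Adj x y ↔ Y.Adj x' y' := by
  rcases ind_cases X x y with h1 | h1 <;> rcases ind_cases Y x' y' with h2 | h2 <;>
    simp_all

theorem ind_eq_of_adj_iff {X Y : SimpleGraph V} {x y x' y' : V}
    (h : X.Adj x y ↔ Y.Adj x' y') : ind X x y = ind Y x' y' :=
  open Classical in if_congr h rfl rfl

theorem Cubic.exists_third {X : SimpleGraph V} (hX : Cubic X) {u p q : V} (hp : X.Adj u p)
    (hq : X.Adj u q) (hpq : p ≠ q) :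
    ∃ a, a ≠ p ∧ a ≠ q ∧ ∀ z, X.Adj u z ↔ z = p ∨ z = q ∨ z = a := by
  obtain ⟨x, y, z, hxy, hxz, hyz, h⟩ := Set.ncard_eq_three.1 (hX u)
  have h' : ∀ w, X.Adj u w ↔ w = x ∨ w = y ∨ w = z := fun w => by
    rw [← mem_neighborSet, h]; simp
  have h1 := (h' p).1 hp
  have h2 := (h' q).1 hq
  rcases h1 with rfl | rfl | rfl <;> rcases h2 with rfl | rfl | rfl <;>
    first
      | exact absurd rfl hpq
      | exact ⟨x, by grind, by grind, fun w => (h' w).trans (by grind)⟩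
      | exact ⟨y, by grind, by grind, fun w => (h' w).trans (by grind)⟩
      | exact ⟨z, by grind, by grind, fun w => (h' w).trans (by grind)⟩

theorem Cubic.of_iso {X Y : SimpleGraph V} (hX : Cubic X) (f : Y ≃g X) : Cubic Y := by
  intro v
  rw [← hX (f v)]
  refine Set.ncard_congr (fun z _ => f z) ?_ ?_ ?_
  · intro z hz
    exact f.map_adj_iff.2 hz
  · intro x y _ _ h
    exact f.injective h
  · intro z hz
    refine ⟨f.symm z, ?_, by simp⟩
    have : Y.Adj v (f.symm z) ↔ X.Adj (f v) z := by
      rw [← f.map_adj_iff]; simp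
    exact this.2 hz

/-- `X` and `Y` agree on all pairs of vertices avoiding `u` and `v`. -/
def AgreeOff (X Y : SimpleGraph V) (u v : V) : Prop :=
  ∀ x y, x ≠ u → x ≠ v → y ≠ u → y ≠ v → (Y.Adj x y ↔ X.Adj x y)

/-- `Y` arises from `X` by exchanging the neighbours `b` of `u` and `d` of `v`. -/
structure Switch (X Y : SimpleGraph V) (u v a b c d : V) : Prop where
  ne : u ≠ v
  agree : AgreeOff X Y u v
  pair : Y.Adj u v ↔ X.Adj u v
  av : a ≠ v
  bv : b ≠ v
  cu : c ≠ u
  du : d ≠ u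
  Xua : X.Adj u a
  Xub : X.Adj u b
  Xuc : ¬ X.Adj u c
  Xud : ¬ X.Adj u d
  Xva : ¬ X.Adj v a
  Xvb : ¬ X.Adj v b
  Xvc : X.Adj v c
  Xvd : X.Adj v d
  Yua : Y.Adj u a
  Yub : ¬ Y.Adj u b
  Yuc : ¬ Y.Adj u c
  Yud : Y.Adj u d
  Yva : ¬ Y.Adj v a
  Yvb : Y.Adj v b
  Yvc : Y.Adj v c
  Yvd : ¬ Y.Adj v d
  Xuv : ∀ z, z ≠ u → z ≠ v → z ≠ a → z ≠ b → z ≠ c → z ≠ d → (X.Adj u z ↔ X.Adj v z)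
  YXu : ∀ z, z ≠ u → z ≠ v → z ≠ a → z ≠ b → z ≠ c → z ≠ d → (Y.Adj u z ↔ X.Adj u z)
  YXv : ∀ z, z ≠ u → z ≠ v → z ≠ a → z ≠ b → z ≠ c → z ≠ d → (Y.Adj v z ↔ X.Adj v z)

theorem Switch.symm {X Y : SimpleGraph V} {u v a b c d : V} (h : Switch X Y u v a b c d) :
    Switch Y X u v a d c b where
  ne := h.ne
  agree := fun x y h1 h2 h3 h4 => (h.agree x y h1 h2 h3 h4).symm
  pair := h.pair.symm
  av := h.av
  bv := by rintro rfl; exact h.Xvd.ne rfl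
  cu := h.cu
  du := by rintro rfl; exact h.Xub.ne rfl
  Xua := h.Yua
  Xub := h.Yud
  Xuc := h.Yuc
  Xud := h.Yub
  Xva := h.Yva
  Xvb := h.Yvd
  Xvc := h.Yvc
  Xvd := h.Yvb
  Yua := h.Xua
  Yub := h.Xud
  Yuc := h.Xuc
  Yud := h.Xub
  Yva := h.Xva
  Yvb := h.Xvd
  Yvc := h.Xvc
  Yvd := h.Xvb
  Xuv := fun z h1 h2 h3 h4 h5 h6 => by
    rw [h.YXu z h1 h2 h3 h6 h5 h4, h.YXv z h1 h2 h3 h6 h5 h4, h.Xuv z h1 h2 h3 h6 h5 h4]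
  YXu := fun z h1 h2 h3 h4 h5 h6 => (h.YXu z h1 h2 h3 h6 h5 h4).symm
  YXv := fun z h1 h2 h3 h4 h5 h6 => (h.YXv z h1 h2 h3 h6 h5 h4).symm

variable [Fintype V]

theorem sum_ind {X : SimpleGraph V} (hX : Cubic X) (v : V) : ∑ z, ind X v z = 3 := by
  classical
  have h := hX v
  rw [Set.ncard_eq_toFinset_card'] at h
  have : X.neighborSet v = {z | X.Adj v z} := rfl
  simp only [ind, Finset.sum_boole]
  rw [← Nat.cast_ofNat, ← h]
  congr 2
  ext z
  simp

section Agree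

variable {X Y : SimpleGraph V} {u v : V}

theorem AgreeOff.ind_add (h : AgreeOff X Y u v) (hX : Cubic X) (hY : Cubic Y) (huv : u ≠ v)
    {w : V} (hu : w ≠ u) (hv : w ≠ v) :
    ind Y u w + ind Y v w = ind X u w + ind X v w := by
  have h1 : ∑ z, (ind X w z - ind Y w z) = 0 := by
    rw [Finset.sum_sub_distrib, sum_ind hX, sum_ind hY, sub_self]
  rw [Fintype.sum_eq_add u v huv] at h1
  · rw [ind_comm Y u, ind_comm Y v, ind_comm X u, ind_comm X v]
    linarith
  · rintro z ⟨hzu, hzv⟩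
    rw [sub_eq_zero]
    exact (ind_eq_of_adj_iff (h w z hu hv hzu hzv)).symm

theorem AgreeOff.adj_pair (h : AgreeOff X Y u v) (hX : Cubic X) (hY : Cubic Y) (huv : u ≠ v) :
    Y.Adj u v ↔ X.Adj u v := by
  have h1 : ∑ z, ((ind X u z - ind Y u z) + (ind X v z - ind Y v z)) = 0 := by
    rw [Finset.sum_add_distrib, Finset.sum_sub_distrib, Finset.sum_sub_distrib, sum_ind hX,
      sum_ind hY, sum_ind hX, sum_ind hY]
    norm_num
  rw [Fintype.sum_eq_add u v huv] at h1
  · have h2 : ∀ (Z : SimpleGraph V) (x : V), ind Z x x = 0 := fun Z x =>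
      ind_of_not_adj (Z.loopless.irrefl x)
    rw [h2, h2, h2, h2, ind_comm X v, ind_comm Y v] at h1
    exact adj_iff_of_ind_eq (by linarith)
  · rintro z ⟨hzu, hzv⟩
    linarith [h.ind_add hX hY huv hzu hzv]

theorem AgreeOff.eq (h : AgreeOff X Y u v) (hX : Cubic X) (hY : Cubic Y) (huv : u ≠ v)
    (hw : ∀ w, w ≠ u → w ≠ v → (Y.Adj u w ↔ X.Adj u w)) : Y = X := by
  have hp := h.adj_pair hX hY huv
  have hw' : ∀ w, w ≠ u → w ≠ v → (Y.Adj v w ↔ X.Adj v w) := fun w h1 h2 => by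
    have h3 := h.ind_add hX hY huv h1 h2
    have h4 := ind_eq_of_adj_iff (hw w h1 h2)
    exact adj_iff_of_ind_eq (by linarith)
  ext x y
  have := X.adj_comm
  have := Y.adj_comm
  have := h x y
  have := X.loopless.irrefl
  have := Y.loopless.irrefl
  by_cases x = u <;> by_cases x = v <;> by_cases y = u <;> by_cases y = v <;> grind

theorem AgreeOff.iso (h : AgreeOff X Y u v) (hX : Cubic X) (hY : Cubic Y) (huv : u ≠ v)
    (hw : ∀ w, w ≠ u → w ≠ v → (Y.Adj u w ↔ X.Adj v w)) : Nonempty (X ≃g Y) := by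
  classical
  have hp := h.adj_pair hX hY huv
  have hw' : ∀ w, w ≠ u → w ≠ v → (Y.Adj v w ↔ X.Adj u w) := fun w h1 h2 => by
    have h3 := h.ind_add hX hY huv h1 h2
    have h4 := ind_eq_of_adj_iff (hw w h1 h2)
    exact adj_iff_of_ind_eq (by linarith)
  refine ⟨⟨Equiv.swap u v, ?_⟩⟩
  intro x y
  have := X.adj_comm
  have := Y.adj_comm
  have := h x y
  have := X.loopless.irrefl
  have := Y.loopless.irrefl
  simp only [Equiv.swap_apply_def]
  by_cases x = u <;> by_cases x = v <;> by_cases y = u <;> by_cases y = v <;> grind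

end Agree

variable [DecidableEq V]

structure Good (X Y : SimpleGraph V) : Prop where
  left : Cubic X
  right : Cubic Y
  deck : SameDeck X Y (Fintype.card V - 2)
  not_iso : IsEmpty (X ≃g Y)

theorem Good.symm {X Y : SimpleGraph V} (h : Good X Y) : Good Y X :=
  ⟨h.right, h.left, sameDeck_symm h.deck, ⟨fun f => h.not_iso.false f.symm⟩⟩

theorem Good.exists_agreeOff {X Y : SimpleGraph V} (h : Good X Y) {u v : V} (huv : u ≠ v) :
    ∃ Y', Good Y' X ∧ AgreeOff X Y' u v := by
  obtain ⟨Y', ⟨f⟩, hY'⟩ := exists_agree_off_pair h.deck huv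
  exact ⟨Y', ⟨h.right.of_iso f, h.left, sameDeck_symm (sameDeck_trans_iso h.deck f.symm),
    ⟨fun i => h.not_iso.false (i.symm.trans f)⟩⟩, hY'⟩

/-- Two vertices have at least two exclusive neighbours each. -/
theorem Good.not_twins {X Y : SimpleGraph V} (h : Good X Y) {u v a c : V} (huv : u ≠ v)
    (hau : X.Adj u a) (hcv : X.Adj v c)
    (hz : ∀ z, z ≠ u → z ≠ v → z ≠ a → z ≠ c → (X.Adj u z ↔ X.Adj v z)) : False := by
  obtain ⟨Y', hY', hag⟩ := h.exists_agreeOff huv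
  have hX := h.left
  have hY := hY'.left
  have hp := ind_eq_of_adj_iff (hag.adj_pair hX hY huv)
  have h0 : ∀ z, z ≠ a → z ≠ c → ind X u z - ind Y' u z = 0 := by
    intro z ha hc
    by_cases hzu : z = u
    · subst hzu
      rw [ind_of_not_adj (X.loopless.irrefl z), ind_of_not_adj (Y'.loopless.irrefl z), sub_self]
    by_cases hzv : z = v
    · subst hzv
      rw [hp, sub_self]
    have h1 := hag.ind_add hX hY huv hzu hzv
    have h2 := ind_eq_of_adj_iff (hz z hzu hzv ha hc)
    rcases ind_cases X u z with h3 | h3 <;> rcases ind_cases Y' u z with h4 | h4 <;>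
      rcases ind_cases Y' v z with h5 | h5 <;> omega
  have hs : ∑ z, (ind X u z - ind Y' u z) = 0 := by
    rw [Finset.sum_sub_distrib, sum_ind hX, sum_ind hY, sub_self]
  have hX1 := ind_of_adj hau
  have key : ∀ w, w ≠ u → w ≠ v → ind Y' u w + ind Y' v w = ind X u w + ind X v w :=
    fun w => hag.ind_add hX hY huv
  by_cases hsame : ind Y' u a = ind X u a
  · have hc : ind Y' u c = ind X u c := by
      by_cases hac : a = c
      · rw [← hac, hsame]
      rw [Fintype.sum_eq_add a c hac (fun z hz => h0 z hz.1 hz.2)] at hs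
      omega
    have : Y' = X := hag.eq hX hY huv fun w _ _ => adj_iff_of_ind_eq (by
      by_cases hwa : w = a
      · rw [hwa, hsame]
      by_cases hwc : w = c
      · rw [hwc, hc]
      have := h0 w hwa hwc
      omega)
    exact hY'.not_iso.false (this ▸ Iso.refl)
  · have hac : a ≠ c := by
      rintro rfl
      rw [Fintype.sum_eq_single a (fun z hz => h0 z hz hz)] at hs
      omega
    rw [Fintype.sum_eq_add a c hac (fun z hz => h0 z hz.1 hz.2)] at hs
    have hav : a ≠ v := by
      rintro rfl
      exact hsame hp
    have ha := key a hau.ne' hav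
    have hcu : c ≠ u := by
      rintro rfl
      have h1 := ind_of_not_adj (X.loopless.irrefl c)
      have h2 := ind_of_not_adj (Y'.loopless.irrefl c)
      omega
    have hcc := key c hcu hcv.ne'
    have hcv1 := ind_of_adj hcv
    obtain ⟨i⟩ := hag.iso hX hY huv fun w hwu hwv => adj_iff_of_ind_eq (by
      have hw := key w hwu hwv
      by_cases hwa : w = a
      · subst hwa
        rcases ind_cases X v w with h3 | h3 <;> rcases ind_cases Y' u w with h4 | h4 <;>
          rcases ind_cases Y' v w with h5 | h5 <;> omega
      by_cases hwc : w = c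
      · subst hwc
        rcases ind_cases X u w with h3 | h3 <;> rcases ind_cases Y' u w with h4 | h4 <;>
          rcases ind_cases Y' v w with h5 | h5 <;> rcases ind_cases Y' u a with h6 | h6 <;> omega
      have := h0 w hwa hwc
      have := ind_eq_of_adj_iff (hz w hwu hwv hwa hwc)
      omega)
    exact hY'.not_iso.false i.symm

theorem Good.no_triangle {X Y : SimpleGraph V} (h : Good X Y) {u v w : V} (huv : X.Adj u v)
    (huw : X.Adj u w) (hvw : X.Adj v w) : False := by
  obtain ⟨a, ha1, ha2, ha⟩ := h.left.exists_third huv huw hvw.ne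
  obtain ⟨c, hc1, hc2, hc⟩ := h.left.exists_third huv.symm hvw huw.ne
  refine h.not_twins huv.ne ((ha a).2 (by simp)) ((hc c).2 (by simp)) fun z h1 h2 h3 h4 => ?_
  rw [ha, hc]
  grind

theorem Good.no_square {X Y : SimpleGraph V} (h : Good X Y) {u v p q : V} (huv : u ≠ v)
    (hpq : p ≠ q) (hup : X.Adj u p) (huq : X.Adj u q) (hvp : X.Adj v p) (hvq : X.Adj v q) :
    False := by
  obtain ⟨a, ha1, ha2, ha⟩ := h.left.exists_third hup huq hpq
  obtain ⟨c, hc1, hc2, hc⟩ := h.left.exists_third hvp hvq hpq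
  refine h.not_twins huv ((ha a).2 (by simp)) ((hc c).2 (by simp)) fun z h1 h2 h3 h4 => ?_
  rw [ha, hc]
  grind

theorem Good.exists_switch {X Y : SimpleGraph V} (h : Good X Y) {u v a b c d : V} (huv : u ≠ v)
    (hab : a ≠ b) (hcd : c ≠ d) (hav : a ≠ v) (hbv : b ≠ v) (hcu : c ≠ u) (hdu : d ≠ u)
    (hua : X.Adj u a) (hub : X.Adj u b) (huc : ¬ X.Adj u c) (hud : ¬ X.Adj u d)
    (hva : ¬ X.Adj v a) (hvb : ¬ X.Adj v b) (hvc : X.Adj v c) (hvd : X.Adj v d)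
    (hz : ∀ z, z ≠ u → z ≠ v → z ≠ a → z ≠ b → z ≠ c → z ≠ d → (X.Adj u z ↔ X.Adj v z)) :
    ∃ Y', Good Y' X ∧ (Switch X Y' u v a b c d ∨ Switch X Y' u v a b d c) := by
  obtain ⟨Y₁, hY₁, hag₁⟩ := h.exists_agreeOff huv
  obtain ⟨Y', hY', hag, hY'ua⟩ : ∃ Y', Good Y' X ∧ AgreeOff X Y' u v ∧ Y'.Adj u a := by
    by_cases hY1a : Y₁.Adj u a
    · exact ⟨Y₁, hY₁, hag₁, hY1a⟩
    let f : Y₁.comap (Equiv.swap u v) ≃g Y₁ := ⟨Equiv.swap u v, by simp⟩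
    refine ⟨Y₁.comap (Equiv.swap u v), ⟨hY₁.left.of_iso f, h.left,
      sameDeck_symm (sameDeck_trans_iso (sameDeck_symm hY₁.deck) f.symm),
      ⟨fun i => hY₁.not_iso.false (f.symm.trans i)⟩⟩, ?_, ?_⟩
    · intro x y h1 h2 h3 h4
      simp only [SimpleGraph.comap_adj, Equiv.swap_apply_of_ne_of_ne h1 h2,
        Equiv.swap_apply_of_ne_of_ne h3 h4]
      exact hag₁ x y h1 h2 h3 h4
    · simp only [SimpleGraph.comap_adj, Equiv.swap_apply_left,
        Equiv.swap_apply_of_ne_of_ne hua.ne' hav]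
      have h1 := hag₁.ind_add h.left hY₁.left huv hua.ne' hav
      rw [ind_of_adj hua, ind_of_not_adj hva, ind_of_not_adj hY1a] at h1
      rcases ind_cases Y₁ v a with h2 | h2
      · exact h2.1
      · omega
  have hX := h.left
  have hY := hY'.left
  have hp := hag.adj_pair hX hY huv
  have key : ∀ w, w ≠ u → w ≠ v → ind Y' u w + ind Y' v w = ind X u w + ind X v w :=
    fun w => hag.ind_add hX hY huv
  have h0 : ∀ z, z ≠ u → z ≠ v → z ≠ a → z ≠ b → z ≠ c → z ≠ d →
      ind Y' u z = ind X u z ∧ ind Y' v z = ind X v z := by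
    intro z hzu hzv ha hb hc hd
    have h1 := key z hzu hzv
    have h2 := ind_eq_of_adj_iff (hz z hzu hzv ha hb hc hd)
    rcases ind_cases X u z with h3 | h3 <;> rcases ind_cases Y' u z with h4 | h4 <;>
      rcases ind_cases Y' v z with h5 | h5 <;> omega
  have hac : a ≠ c := by rintro rfl; exact huc hua
  have had : a ≠ d := by rintro rfl; exact hud hua
  have hbc : b ≠ c := by rintro rfl; exact huc hub
  have hbd : b ≠ d := by rintro rfl; exact hud hub
  have hs : ∑ z ∈ ({a, b, c, d} : Finset V), (ind X u z - ind Y' u z) = 0 := by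
    rw [Finset.sum_subset (Finset.subset_univ _), Finset.sum_sub_distrib, sum_ind hX, sum_ind hY,
      sub_self]
    intro z _ hzn
    simp only [Finset.mem_insert, Finset.mem_singleton, not_or] at hzn
    by_cases hzu : z = u
    · subst hzu
      rw [ind_of_not_adj (X.loopless.irrefl z), ind_of_not_adj (Y'.loopless.irrefl z), sub_self]
    by_cases hzv : z = v
    · subst hzv
      rw [ind_eq_of_adj_iff hp, sub_self]
    rw [(h0 z hzu hzv hzn.1 hzn.2.1 hzn.2.2.1 hzn.2.2.2).1, sub_self]
  rw [Finset.sum_insert (by simp [hab, hac, had]), Finset.sum_insert (by simp [hbc, hbd]),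
    Finset.sum_insert (by simp [hcd]), Finset.sum_singleton, ind_of_adj hua, ind_of_adj hub,
    ind_of_not_adj huc, ind_of_not_adj hud, ind_of_adj hY'ua] at hs
  have ka := key a hua.ne' hav
  have kb := key b hub.ne' hbv
  have kc := key c hcu hvc.ne'
  have kd := key d hdu hvd.ne'
  rw [ind_of_adj hua, ind_of_not_adj hva, ind_of_adj hY'ua] at ka
  rw [ind_of_adj hub, ind_of_not_adj hvb] at kb
  rw [ind_of_adj hvc, ind_of_not_adj huc] at kc
  rw [ind_of_adj hvd, ind_of_not_adj hud] at kd
  have hYva : ¬ Y'.Adj v a := by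
    intro hh
    rw [ind_of_adj hh] at ka
    omega
  have hYub : ¬ Y'.Adj u b := by
    intro hh
    rw [ind_of_adj hh] at hs kb
    have hc0 : ind Y' u c = 0 := by
      rcases ind_cases Y' u c with h1 | h1 <;> rcases ind_cases Y' u d with h2 | h2 <;> omega
    have hd0 : ind Y' u d = 0 := by omega
    have : Y' = X := hag.eq hX hY huv fun w hwu hwv => by
      by_cases hwa : w = a
      · rw [hwa]; simp [hua, hY'ua]
      by_cases hwb : w = b
      · rw [hwb]; simp [hub, hh]
      by_cases hwc : w = c
      · rw [hwc]; exact adj_iff_of_ind_eq (by rw [hc0, ind_of_not_adj huc])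
      by_cases hwd : w = d
      · rw [hwd]; exact adj_iff_of_ind_eq (by rw [hd0, ind_of_not_adj hud])
      exact adj_iff_of_ind_eq (h0 w hwu hwv hwa hwb hwc hwd).1
    exact hY'.not_iso.false (this ▸ Iso.refl)
  rw [ind_of_not_adj hYub] at hs kb
  have hYvb : Y'.Adj v b := by
    rcases ind_cases Y' v b with h1 | h1
    · exact h1.1
    · omega
  refine ⟨Y', hY', ?_⟩
  rcases ind_cases Y' u c with h1 | h1 <;> rcases ind_cases Y' u d with h2 | h2 <;>
    rcases ind_cases Y' v c with h3 | h3 <;> rcases ind_cases Y' v d with h4 | h4 <;>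
    first
      | omega
      | exact Or.inl ⟨huv, hag, hp, hav, hbv, hcu, hdu, hua, hub, huc, hud, hva, hvb, hvc, hvd,
          hY'ua, hYub, h1.1, h2.1, hYva, hYvb, h3.1, h4.1, hz,
          fun z i1 i2 i3 i4 i5 i6 => adj_iff_of_ind_eq (h0 z i1 i2 i3 i4 i5 i6).1,
          fun z i1 i2 i3 i4 i5 i6 => adj_iff_of_ind_eq (h0 z i1 i2 i3 i4 i5 i6).2⟩
      | exact Or.inr ⟨huv, hag, hp, hav, hbv, hdu, hcu, hua, hub, hud, huc, hva, hvb, hvd, hvc,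
          hY'ua, hYub, h2.1, h1.1, hYva, hYvb, h4.1, h3.1,
          fun z i1 i2 i3 i4 i5 i6 => hz z i1 i2 i3 i4 i6 i5,
          fun z i1 i2 i3 i4 i5 i6 => adj_iff_of_ind_eq (h0 z i1 i2 i3 i4 i6 i5).1,
          fun z i1 i2 i3 i4 i5 i6 => adj_iff_of_ind_eq (h0 z i1 i2 i3 i4 i6 i5).2⟩

end Cubic

section Ears

variable {V : Type*}

/-- A cycle of length `g`, given as a `g`-periodic sequence. -/
structure Cyc (X : SimpleGraph V) (g : ℕ) (c : ℤ → V) : Prop where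
  three_le : 3 ≤ g
  eq_iff : ∀ i j, c i = c j ↔ (g : ℤ) ∣ i - j
  adj : ∀ i, X.Adj (c i) (c (i + 1))

/-- A walk of length `ℓ` from `c i` to `c j` with all inner vertices off the cycle `c`. -/
structure Ear (X : SimpleGraph V) (c : ℤ → V) (ℓ : ℕ) (i j : ℤ) (p : ℕ → V) : Prop where
  two_le : 2 ≤ ℓ
  start : p 0 = c i
  finish : p ℓ = c j
  ne : c i ≠ c j
  adj : ∀ t < ℓ, X.Adj (p t) (p (t + 1))
  off : ∀ t, 0 < t → t < ℓ → ∀ k, p t ≠ c k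

def HasEar (X : SimpleGraph V) (c : ℤ → V) (ℓ : ℕ) (i j : ℤ) : Prop := ∃ p, Ear X c ℓ i j p

theorem add_one_emod (k : ℤ) {g : ℕ} (hg : 0 < g) :
    (k % g + 1 < g ∧ (k + 1) % g = k % g + 1) ∨ (k % g = g - 1 ∧ (k + 1) % g = 0) := by
  have h1 : 0 ≤ k % g := Int.emod_nonneg _ (by omega)
  have h2 : k % g < g := Int.emod_lt_of_pos _ (by omega)
  have h3 : (k + 1) % g = (k % g + 1) % g := (Int.emod_add_emod _ _ _).symm
  rcases lt_or_ge (k % g + 1) g with h | h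
  · exact Or.inl ⟨h, by rw [h3, Int.emod_eq_of_lt (by omega) h]⟩
  · have h4 : k % g + 1 = g := by omega
    exact Or.inr ⟨by omega, by rw [h3, h4, Int.emod_self]⟩

theorem Cyc.of_path {X : SimpleGraph V} {g : ℕ} (hg : 3 ≤ g) (x : ℤ → V)
    (hinj : ∀ s t : ℤ, 0 ≤ s → s < g → 0 ≤ t → t < g → x s = x t → s = t)
    (hadj : ∀ k : ℤ, 0 ≤ k → k + 1 < g → X.Adj (x k) (x (k + 1)))
    (hclose : X.Adj (x (g - 1)) (x 0)) : Cyc X g fun k => x (k % g) where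
  three_le := hg
  eq_iff i j := by
    have h : ∀ k : ℤ, 0 ≤ k % g ∧ k % g < g := fun k =>
      ⟨Int.emod_nonneg _ (by omega), Int.emod_lt_of_pos _ (by omega)⟩
    rw [Int.dvd_iff_emod_eq_zero, ← Int.emod_eq_emod_iff_emod_sub_eq_zero]
    exact ⟨fun hx => hinj _ _ (h i).1 (h i).2 (h j).1 (h j).2 hx, fun hx => by rw [hx]⟩
  adj k := by
    rcases add_one_emod k (show 0 < g by omega) with ⟨h1, h2⟩ | ⟨h1, h2⟩
    · rw [h2]
      exact hadj _ (Int.emod_nonneg _ (by omega)) h1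
    · rw [h1, h2]
      exact hclose

theorem Int.eq_of_dvd_sub_of_lt {g s t : ℤ} (h : g ∣ s - t) (h1 : s - t < g) (h2 : t - s < g) :
    s = t := by
  have := Int.eq_zero_of_abs_lt_dvd h (abs_lt.2 ⟨by omega, h1⟩)
  omega

section Cyc

variable {X Y : SimpleGraph V} {g ℓ : ℕ} {c : ℤ → V}

theorem Cyc.eq_of (hc : Cyc X g c) {i j : ℤ} (h : c i = c j) (h1 : i - j < g) (h2 : j - i < g) :
    i = j :=
  Int.eq_of_dvd_sub_of_lt ((hc.eq_iff i j).1 h) h1 h2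

theorem Cyc.sub_cycle (hc : Cyc X g c) {g' : ℕ} (h3 : 3 ≤ g') (hg : g' ≤ g) (i : ℤ)
    (hadj : ∀ k : ℤ, 0 ≤ k → k + 1 < g' → Y.Adj (c (i + k)) (c (i + k + 1)))
    (hclose : Y.Adj (c (i + (g' - 1))) (c i)) : Cyc Y g' fun k => c (i + k % g') := by
  refine Cyc.of_path h3 (fun k => c (i + k)) ?_ ?_ ?_
  · intro s t h1 h2 h4 h5 h
    have := hc.eq_of h (by omega) (by omega)
    omega
  · intro k h1 h2
    rw [← add_assoc]
    exact hadj k h1 h2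
  · simpa using hclose

theorem Cyc.periodic (hc : Cyc X g c) (i : ℤ) : c (i + g) = c i := by
  rw [hc.eq_iff]
  simp

theorem HasEar.symm {i j : ℤ} (h : HasEar X c ℓ i j) : HasEar X c ℓ j i := by
  obtain ⟨p, hp⟩ := h
  refine ⟨fun t => p (ℓ - t), hp.two_le, by simpa using hp.finish, by simpa using hp.start,
    hp.ne.symm, fun t ht => ?_, fun t h1 h2 => hp.off _ (by omega) (by omega)⟩
  have := hp.adj (ℓ - (t + 1)) (by omega)
  rw [show ℓ - (t + 1) + 1 = ℓ - t by omega] at this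
  exact this.symm

theorem HasEar.congr {i j i' j' : ℤ} (h : HasEar X c ℓ i j) (hi : c i = c i') (hj : c j = c j') :
    HasEar X c ℓ i' j' := by
  obtain ⟨p, hp⟩ := h
  exact ⟨p, hp.two_le, hp.start.trans hi, hp.finish.trans hj, hi ▸ hj ▸ hp.ne, hp.adj, hp.off⟩

/-- `f i` is the neighbour of `c i` off the cycle `c`. -/
structure Third (X : SimpleGraph V) (c f : ℤ → V) : Prop where
  off : ∀ i k, f i ≠ c k
  adj_iff : ∀ i z, X.Adj (c i) z ↔ z = c (i - 1) ∨ z = c (i + 1) ∨ z = f i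

theorem Cyc.adj_pred (hc : Cyc X g c) (i : ℤ) : X.Adj (c i) (c (i - 1)) := by
  have := hc.adj (i - 1)
  rw [sub_add_cancel] at this
  exact this.symm

theorem Third.adj {f : ℤ → V} (hf : Third X c f) (i : ℤ) : X.Adj (c i) (f i) :=
  (hf.adj_iff i _).2 (by simp)

theorem Third.eq_of_adj {f : ℤ → V} (hf : Third X c f) {i : ℤ} {z : V} (h : X.Adj (c i) z)
    (hz : ∀ k, z ≠ c k) : z = f i := by
  rcases (hf.adj_iff i z).1 h with h | h | h
  · exact absurd h (hz _)
  · exact absurd h (hz _)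
  · exact h

end Cyc

theorem exists_longest_path [Finite V] [Nonempty V] (X : SimpleGraph V) :
    ∃ (L : ℕ) (x : ℕ → V), Set.InjOn x (Set.Iic L) ∧ (∀ t < L, X.Adj (x t) (x (t + 1))) ∧
      ∀ z, X.Adj (x 0) z → ∃ t, 0 < t ∧ t ≤ L ∧ x t = z := by
  classical
  let P : ℕ → Prop := fun L =>
    ∃ x : ℕ → V, Set.InjOn x (Set.Iic L) ∧ ∀ t < L, X.Adj (x t) (x (t + 1))
  have hcard : ∀ L, P L → L + 1 ≤ Nat.card V := by
    rintro L ⟨x, hx, -⟩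
    have := hx.ncard_image
    rw [Set.ncard_eq_toFinset_card' (Set.Iic L)] at this
    simp only [Set.toFinset_Iic, Nat.card_Iic] at this
    rw [← this, ← Set.ncard_univ]
    exact Set.ncard_le_ncard (Set.subset_univ _)
  have hP0 : P 0 := ⟨fun _ => Classical.arbitrary V, fun a ha b hb _ => by
    simp only [Set.mem_Iic] at ha hb
    omega, by simp⟩
  have hspec := Nat.findGreatest_spec (P := P) (Nat.zero_le (Nat.card V)) hP0
  have hmax : ¬ P (Nat.findGreatest P (Nat.card V) + 1) := fun h =>
    Nat.findGreatest_is_greatest (Nat.lt_succ_self _) (by have := hcard _ h; omega) h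
  obtain ⟨x, hx, hadj⟩ := hspec
  refine ⟨_, x, hx, hadj, fun z hz => ?_⟩
  by_contra! hcon
  refine hmax ⟨fun t => if t = 0 then z else x (t - 1), ?_, ?_⟩
  · intro a ha b hb hab
    simp only [Set.mem_Iic] at ha hb
    have hz0 : x 0 ≠ z := hz.ne
    have hxz : ∀ t ≤ Nat.findGreatest P (Nat.card V), x t ≠ z := fun t ht => by
      rcases Nat.eq_zero_or_pos t with rfl | h0
      · exact hz0
      · exact hcon t h0 ht
    by_cases h1 : a = 0 <;> by_cases h2 : b = 0 <;> simp only [h1, h2, if_true, if_false] at hab ⊢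
    · exact absurd hab.symm (hxz _ (by omega))
    · exact absurd hab (hxz _ (by omega))
    · have := hx (x₁ := a - 1) (x₂ := b - 1) (by simp only [Set.mem_Iic]; omega)
        (by simp only [Set.mem_Iic]; omega) hab
      omega
  · intro t ht
    by_cases h1 : t = 0
    · subst h1
      simpa using hz.symm
    · have := hadj (t - 1) (by omega)
      rw [show t - 1 + 1 = t by omega] at this
      simpa [h1] using this

theorem Cubic.exists_cyc_ear [Finite V] [Nonempty V] {X : SimpleGraph V} (hX : Cubic X) :
    ∃ g c ℓ i j, Cyc X g c ∧ HasEar X c ℓ i j := by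
  obtain ⟨L, x, hinj, hadj, hend⟩ := exists_longest_path X
  obtain ⟨i, j, hi, hij, hj, hxi, hxj⟩ : ∃ i j, 2 ≤ i ∧ i < j ∧ j ≤ L ∧
      X.Adj (x 0) (x i) ∧ X.Adj (x 0) (x j) := by
    obtain ⟨a, b, d, hab, had, hbd, h⟩ := Set.ncard_eq_three.1 (hX (x 0))
    have ha : X.Adj (x 0) a := by rw [← mem_neighborSet, h]; simp
    have hb : X.Adj (x 0) b := by rw [← mem_neighborSet, h]; simp
    have hd : X.Adj (x 0) d := by rw [← mem_neighborSet, h]; simp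
    obtain ⟨r, hr0, hrL, rfl⟩ := hend a ha
    obtain ⟨s, hs0, hsL, rfl⟩ := hend b hb
    obtain ⟨t, ht0, htL, rfl⟩ := hend d hd
    have h1 : r ≠ s := fun h => hab (by rw [h])
    have h2 : r ≠ t := fun h => had (by rw [h])
    have h3 : s ≠ t := fun h => hbd (by rw [h])
    by_cases hr : r = 1
    · rcases lt_or_gt_of_ne h3 with h | h
      · exact ⟨s, t, by omega, h, htL, hb, hd⟩
      · exact ⟨t, s, by omega, h, hsL, hd, hb⟩
    by_cases hs : s = 1
    · rcases lt_or_gt_of_ne h2 with h | h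
      · exact ⟨r, t, by omega, h, htL, ha, hd⟩
      · exact ⟨t, r, by omega, h, hrL, hd, ha⟩
    · rcases lt_or_gt_of_ne h1 with h | h
      · exact ⟨r, s, by omega, h, hsL, ha, hb⟩
      · exact ⟨s, r, by omega, h, hrL, hb, ha⟩
  have hinj' : ∀ s t, s ≤ L → t ≤ L → x s = x t → s = t := fun s t hs ht h =>
    hinj (Set.mem_Iic.2 hs) (Set.mem_Iic.2 ht) h
  have hmod : ∀ k : ℤ, 0 ≤ k % (i + 1 : ℕ) ∧ k % (i + 1 : ℕ) < (i + 1 : ℕ) := fun k =>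
    ⟨Int.emod_nonneg _ (by omega), Int.emod_lt_of_pos _ (by omega)⟩
  have hi' : ((i : ℤ) % (i + 1 : ℕ)) = i := Int.emod_eq_of_lt (by omega) (by omega)
  refine ⟨i + 1, fun k => x ((k % (i + 1 : ℕ)).toNat), j + 1 - i, 0, i,
    Cyc.of_path (by omega) (fun k => x k.toNat) ?_ ?_ ?_,
    fun t => if t = 0 then x 0 else x (j + 1 - t), by omega, by simp, ?_, ?_, ?_, ?_⟩
  · intro s t h1 h2 h3 h4 h
    have := hinj' s.toNat t.toNat (by omega) (by omega) h
    omega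
  · intro k h1 h2
    have := hadj k.toNat (by omega)
    rwa [show k.toNat + 1 = (k + 1).toNat by omega] at this
  · simpa using hxi.symm
  · rw [hi']
    simp only [show j + 1 - i ≠ 0 by omega, if_false]
    congr 1
    omega
  · rw [hi']
    intro h
    have := hinj' _ _ (by simp) (by omega) h
    simp at this
    omega
  · intro t ht
    by_cases h0 : t = 0
    · subst h0
      simpa using hxj
    · have := hadj (j - t) (by omega)
      simp only [h0, if_false, show t + 1 ≠ 0 by omega]
      rw [show j - t + 1 = j + 1 - t by omega] at this
      rw [show j + 1 - (t + 1) = j - t by omega]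
      exact this.symm
  · intro t h1 h2 k h
    simp only [show t ≠ 0 by omega, if_false] at h
    have := hmod k
    have := hinj' _ _ (by omega) (by omega) h
    omega

end Ears

section Minimal

variable {V : Type*} [Fintype V] [DecidableEq V]

/-- Among all good pairs on `V`, no cycle with an ear is shorter than `g`, and no ear of a
`g`-cycle is shorter than `ℓ`. -/
structure Minimal (V : Type*) [Fintype V] [DecidableEq V] (g ℓ : ℕ) : Prop where
  cycle : ∀ X Y : SimpleGraph V, Good X Y → ∀ g' < g, ∀ c, Cyc X g' c →
    ∀ ℓ' i j, ¬ HasEar X c ℓ' i j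
  ear : ∀ X Y : SimpleGraph V, Good X Y → ∀ c, Cyc X g c →
    ∀ ℓ' < ℓ, ∀ i j, ¬ HasEar X c ℓ' i j

variable {X Y : SimpleGraph V} {g ℓ : ℕ} {c : ℤ → V}

theorem Minimal.chordless (hm : Minimal V g ℓ) (h : Good X Y) (hc : Cyc X g c) {i j : ℤ}
    (hij : X.Adj (c i) (c j)) : (g : ℤ) ∣ j - (i + 1) ∨ (g : ℤ) ∣ j - (i - 1) := by
  have h3 := hc.three_le
  have h0 : 0 ≤ (j - i) % g := Int.emod_nonneg _ (by omega)
  have hlt : (j - i) % g < g := Int.emod_lt_of_pos _ (by omega)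
  obtain ⟨s, hs⟩ := Int.eq_ofNat_of_zero_le h0
  have hd : (g : ℤ) ∣ j - (i + s) := by
    have := Int.dvd_self_sub_emod (x := j - i) (m := g)
    rw [hs] at this
    rwa [show j - (i + s) = j - i - s by ring]
  have hj : c j = c (i + s) := (hc.eq_iff _ _).2 hd
  rw [hj] at hij
  have hs0 : s ≠ 0 := by
    rintro rfl
    simp at hij
  by_cases hs1 : s = 1
  · left
    rw [hs1] at hd
    exact_mod_cast hd
  by_cases hsg : s = g - 1
  · right
    have := dvd_add hd (dvd_refl (g : ℤ))
    rwa [show j - (i + s) + g = j - (i - 1) by omega] at this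
  exfalso
  refine hm.cycle X Y h (s + 1) (by omega) (fun k => c (i + k % (s + 1 : ℕ)))
    (hc.sub_cycle (by omega) (by omega) i (fun k _ _ => hc.adj _) ?_) (g - s) 0 s
    ⟨fun t => c (i - t), by omega, by simp, ?_, ?_, ?_, ?_⟩
  · push_cast
    simpa using hij.symm
  · rw [Int.emod_eq_of_lt (by omega) (by omega), hc.eq_iff]
    exact ⟨-1, by push_cast [show s ≤ g by omega]; ring⟩
  · rw [Int.emod_eq_of_lt (a := s) (by omega) (by omega)]
    simpa using hij.ne
  · intro t ht
    have := hc.adj (i - (t + 1))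
    rw [show i - (t + 1 : ℤ) + 1 = i - t by ring] at this
    push_cast
    exact this.symm
  · intro t h1 h2 k heq
    have h4 : 0 ≤ k % (s + 1 : ℕ) := Int.emod_nonneg _ (by omega)
    have h5 : k % (s + 1 : ℕ) < (s + 1 : ℕ) := Int.emod_lt_of_pos _ (by omega)
    have := hc.eq_of heq (by omega) (by omega)
    omega

theorem Minimal.exists_third (hm : Minimal V g ℓ) (h : Good X Y) (hc : Cyc X g c) :
    ∃ f, Third X c f := by
  have h3 := hc.three_le
  have : ∀ i, ∃ b, (∀ k, b ≠ c k) ∧ ∀ z, X.Adj (c i) z ↔ z = c (i - 1) ∨ z = c (i + 1) ∨ z = b := by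
    intro i
    obtain ⟨b, hb1, hb2, hb⟩ := h.left.exists_third (hc.adj_pred i) (hc.adj i) (fun heq => by
      have := hc.eq_of heq (by omega) (by omega)
      omega)
    refine ⟨b, fun k hk => ?_, hb⟩
    subst hk
    rcases hm.chordless h hc ((hb (c k)).2 (by simp)) with h1 | h1
    · exact hb2 ((hc.eq_iff _ _).2 h1)
    · exact hb1 ((hc.eq_iff _ _).2 h1)
  choose f hf using this
  exact ⟨f, fun i => (hf i).1, fun i => (hf i).2⟩

theorem Good.five_le (h : Good X Y) (hc : Cyc X g c) : 5 ≤ g := by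
  have h3 := hc.three_le
  have h0 := hc.adj 0
  have h1 := hc.adj 1
  have h2 := hc.adj 2
  have h4 := hc.adj 3
  norm_num at h0 h1 h2 h4
  by_contra hlt
  obtain rfl | rfl : g = 3 ∨ g = 4 := by omega
  · have : c 3 = c 0 := by simpa using hc.periodic 0
    rw [this] at h2
    exact h.no_triangle h0 h2.symm h1
  · have : c 4 = c 0 := by simpa using hc.periodic 0
    rw [this] at h4
    refine h.no_square (u := c 0) (v := c 2) (p := c 1) (q := c 3) (fun heq => ?_) (fun heq => ?_)
      h0 h4.symm h1.symm h2
    · have := hc.eq_of heq (by norm_num) (by norm_num)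
      omega
    · have := hc.eq_of heq (by norm_num) (by norm_num)
      omega

theorem Minimal.ear_injective (hm : Minimal V g ℓ) (h : Good X Y) (hc : Cyc X g c) {i j : ℤ}
    {p : ℕ → V} (hp : Ear X c ℓ i j p) {s t : ℕ} (hs : s ≤ ℓ) (ht : t ≤ ℓ) (hst : p s = p t) :
    s = t := by
  wlog hlt : s < t generalizing s t
  · by_contra hne
    exact hne (this ht hs hst.symm (by omega)).symm
  exfalso
  have h2 := hp.two_le
  have hs0 : 0 < s := by
    by_contra h0
    obtain rfl : s = 0 := by omega
    rw [hp.start] at hst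
    by_cases htl : t = ℓ
    · rw [htl, hp.finish] at hst
      exact hp.ne hst
    · exact hp.off t hlt (by omega) i hst.symm
  have htl : t < ℓ := by
    by_contra h0
    obtain rfl : t = ℓ := by omega
    rw [hp.finish] at hst
    exact hp.off s hs0 hlt j hst
  refine hm.ear X Y h c hc (ℓ - (t - s)) (by omega) i j
    ⟨fun r => if r ≤ s then p r else p (r + (t - s)), by omega, by simpa using hp.start, ?_,
      hp.ne, ?_, ?_⟩
  · simp only [show ¬ ℓ - (t - s) ≤ s by omega, if_false]
    rw [show ℓ - (t - s) + (t - s) = ℓ by omega, hp.finish]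
  · intro r hr
    by_cases h1 : r < s
    · simp only [show r ≤ s by omega, show r + 1 ≤ s by omega, if_true]
      exact hp.adj r (by omega)
    by_cases h4 : r = s
    · subst h4
      simp only [le_refl, if_true, show ¬ r + 1 ≤ r by omega, if_false]
      rw [hst, show r + 1 + (t - r) = t + 1 by omega]
      exact hp.adj t htl
    · simp only [show ¬ r ≤ s by omega, show ¬ r + 1 ≤ s by omega, if_false]
      rw [show r + 1 + (t - s) = r + (t - s) + 1 by omega]
      exact hp.adj _ (by omega)
  · intro r h1 h4 k
    by_cases h5 : r ≤ s
    · simp only [h5, if_true]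
      exact hp.off r h1 (by omega) k
    · simp only [h5, if_false]
      exact hp.off _ (by omega) (by omega) k

theorem Minimal.ear_card (hm : Minimal V g ℓ) (h : Good X Y) (hc : Cyc X g c) {i j : ℤ}
    {p : ℕ → V} (hp : Ear X c ℓ i j p) : ℓ + 1 ≤ Fintype.card V - 2 := by
  have h5 := h.five_le hc
  have hoff : ∀ k, c k ≠ c i → c k ≠ c j → ∀ t ≤ ℓ, p t ≠ c k := by
    intro k hki hkj t ht heq
    by_cases h0 : t = 0
    · subst h0
      exact hki (heq.symm.trans hp.start)
    by_cases hl : t = ℓ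
    · subst hl
      exact hkj (heq.symm.trans hp.finish)
    · exact hp.off t (by omega) (by omega) k heq
  obtain ⟨k, k', hkk, hki, hkj, hki', hkj'⟩ : ∃ k k', c k ≠ c k' ∧ c k ≠ c i ∧ c k ≠ c j ∧
      c k' ≠ c i ∧ c k' ≠ c j := by
    have hd : ∀ s t : ℤ, 0 ≤ s → s ≤ 3 → 0 ≤ t → t ≤ 3 → s ≠ t → c (i + s) ≠ c (i + t) := by
      intro s t h1 h2 h3 h4 hst heq
      have := hc.eq_of heq (by omega) (by omega)
      omega
    have h12 := hd 1 2 (by simp) (by simp) (by simp) (by simp) (by simp)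
    have h13 := hd 1 3 (by simp) (by simp) (by simp) (by simp) (by simp)
    have h23 := hd 2 3 (by simp) (by simp) (by simp) (by simp) (by simp)
    have h1 := hd 1 0 (by simp) (by simp) (by simp) (by simp) (by simp)
    have h2 := hd 2 0 (by simp) (by simp) (by simp) (by simp) (by simp)
    have h3 := hd 3 0 (by simp) (by simp) (by simp) (by simp) (by simp)
    rw [add_zero] at h1 h2 h3
    by_cases hj1 : c (i + 1) = c j
    · exact ⟨i + 2, i + 3, h23, h2, hj1 ▸ h12.symm, h3, hj1 ▸ h13.symm⟩
    by_cases hj2 : c (i + 2) = c j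
    · exact ⟨i + 1, i + 3, h13, h1, hj1, h3, hj2 ▸ h23.symm⟩
    · exact ⟨i + 1, i + 2, h12, h1, hj1, h2, hj2⟩
  have hcard : ((Finset.range (ℓ + 1)).image p).card = ℓ + 1 := by
    rw [Finset.card_image_of_injOn, Finset.card_range]
    intro s hs t ht hst
    simp only [Finset.coe_range, Set.mem_Iio] at hs ht
    exact hm.ear_injective h hc hp (by omega) (by omega) hst
  have hk : c k ∉ (Finset.range (ℓ + 1)).image p := by
    simp only [Finset.mem_image, Finset.mem_range, not_exists, not_and]
    exact fun t ht => hoff k hki hkj t (by omega)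
  have hk' : c k' ∉ insert (c k) ((Finset.range (ℓ + 1)).image p) := by
    simp only [Finset.mem_insert, Finset.mem_image, Finset.mem_range, not_or, not_exists, not_and]
    exact ⟨hkk.symm, fun t ht => hoff k' hki' hkj' t (by omega)⟩
  have := Finset.card_le_univ (insert (c k') (insert (c k) ((Finset.range (ℓ + 1)).image p)))
  rw [Finset.card_insert_of_notMem hk', Finset.card_insert_of_notMem hk, hcard] at this
  omega

end Minimal

section Cycle

variable {V : Type*} {X : SimpleGraph V} {g : ℕ} {c : ℤ → V}

theorem Cyc.not_adj_of {f : ℤ → V} (hc : Cyc X g c) (hf : Third X c f) {i j : ℤ} (h : i + 2 ≤ j)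
    (h' : j ≤ i + g - 2) : ¬ X.Adj (c i) (c j) := by
  intro hadj
  rcases (hf.adj_iff i _).1 hadj with h1 | h1 | h1
  · rw [← hc.periodic (i - 1)] at h1
    have := hc.eq_of h1.symm (by omega) (by omega)
    omega
  · have := hc.eq_of h1 (by omega) (by omega)
    omega
  · exact hf.off _ _ h1.symm

theorem Switch.middle_adj {Z : SimpleGraph V} {w : ℤ} {i : ℤ} {a b d e : V}
    (hs : Switch X Z (c i) (c (i + w)) a b d e) (hc : Cyc X g c) (hg : 5 ≤ g)
    (hw : w = 1 ∨ w = 2) (ha : c (i + 1) ≠ a) (hb : c (i + 1) ≠ b) (hd : c (i + 1) ≠ d)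
    (he : c (i + 1) ≠ e) {t : ℤ} (h0 : 0 ≤ t) (ht : t < w) :
    Z.Adj (c (i + t)) (c (i + t + 1)) := by
  rcases hw with rfl | rfl
  · obtain rfl : t = 0 := by omega
    rw [add_zero]
    exact hs.pair.2 (hc.adj i)
  · have h1 : c (i + 1) ≠ c i := fun h => by
      have := hc.eq_of h (by omega) (by omega)
      omega
    have h2 : c (i + 1) ≠ c (i + 2) := fun h => by
      have := hc.eq_of h (by omega) (by omega)
      omega
    obtain rfl | rfl : t = 0 ∨ t = 1 := by omega
    · rw [add_zero]
      exact (hs.YXu _ h1 h2 ha hb hd he).2 (hc.adj i)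
    · have h3 := hc.adj (i + 1)
      rw [show i + 1 + 1 = i + 2 by ring] at h3 ⊢
      exact ((hs.YXv _ h1 h2 ha hb hd he).2 h3.symm).symm

end Cycle

section Star

variable {V : Type*} [Fintype V] [DecidableEq V] {X Y : SimpleGraph V} {g ℓ : ℕ} {c : ℤ → V}

theorem Minimal.not_switch_ear (hm : Minimal V g ℓ) {Z : SimpleGraph V} (hX : Good X Z)
    (hY : Good Y X) (hc : Cyc X g c)
    {i j : ℤ} {p : ℕ → V} (hp : Ear X c ℓ i j p) {t : ℕ} (ht : t + 2 < ℓ) {z b : V}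
    (hs : Switch X Y (p (t + 1)) (p (t + 2)) (p t) z b (p (t + 3))) : False := by
  have hoff : ∀ k, c k ≠ p (t + 1) ∧ c k ≠ p (t + 2) := fun k =>
    ⟨(hp.off _ (by omega) (by omega) k).symm, (hp.off _ (by omega) (by omega) k).symm⟩
  have hcY : Cyc Y g c := ⟨hc.three_le, hc.eq_iff, fun k =>
    (hs.agree _ _ (hoff _).1 (hoff _).2 (hoff _).1 (hoff _).2).2 (hc.adj k)⟩
  have hne : ∀ s ≤ ℓ, ∀ r ≤ ℓ, s ≠ r → p s ≠ p r := fun s h1 r h2 hsr heq =>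
    hsr (hm.ear_injective hX hc hp h1 h2 heq)
  refine hm.ear Y X hY c hcY (ℓ - 1) (by omega) i j
    ⟨fun s => if s ≤ t + 1 then p s else p (s + 1), by omega, by simpa using hp.start, ?_, hp.ne,
      ?_, ?_⟩
  · simp only [show ¬ ℓ - 1 ≤ t + 1 by omega, if_false]
    rw [show ℓ - 1 + 1 = ℓ by omega, hp.finish]
  · intro s hsl
    by_cases h1 : s < t
    · simp only [show s ≤ t + 1 by omega, show s + 1 ≤ t + 1 by omega, if_true]
      exact (hs.agree _ _ (hne _ (by omega) _ (by omega) (by omega))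
        (hne _ (by omega) _ (by omega) (by omega)) (hne _ (by omega) _ (by omega) (by omega))
        (hne _ (by omega) _ (by omega) (by omega))).2 (hp.adj s (by omega))
    by_cases h2 : s = t
    · subst h2
      simp only [show s ≤ s + 1 by omega, le_refl, if_true]
      exact hs.Yua.symm
    by_cases h3 : s = t + 1
    · subst h3
      simp only [show ¬ t + 1 + 1 ≤ t + 1 by omega, le_refl, if_true, if_false]
      exact hs.Yud
    · simp only [show ¬ s ≤ t + 1 by omega, show ¬ s + 1 ≤ t + 1 by omega, if_false]
      exact (hs.agree _ _ (hne _ (by omega) _ (by omega) (by omega))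
        (hne _ (by omega) _ (by omega) (by omega)) (hne _ (by omega) _ (by omega) (by omega))
        (hne _ (by omega) _ (by omega) (by omega))).2 (hp.adj (s + 1) (by omega))
  · intro s h1 h2 k
    by_cases h3 : s ≤ t + 1
    · simp only [h3, if_true]
      exact hp.off s h1 (by omega) k
    · simp only [h3, if_false]
      exact hp.off _ (by omega) (by omega) k

theorem Minimal.ears_agree (hm : Minimal V g ℓ) (h : Good X Y) (hc : Cyc X g c) {i j j' : ℤ}
    {p p' : ℕ → V} (hp : Ear X c ℓ i j p) (hp' : Ear X c ℓ i j' p') (h1 : p 1 = p' 1)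
    (h2 : p 2 = p' 2) : c j = c j' := by
  have key : ∀ s, s ≤ ℓ → ∀ r ≤ s, p r = p' r := by
    intro s
    induction s with
    | zero =>
      intro _ r hr
      obtain rfl : r = 0 := by omega
      rw [hp.start, hp'.start]
    | succ s ih =>
      intro hs r hr
      have ih := ih (by omega)
      by_cases hrs : r ≤ s
      · exact ih r hrs
      obtain rfl : r = s + 1 := by omega
      match s, ih, hs with
      | 0, _, _ => exact h1
      | 1, _, _ => exact h2
      | t + 2, ih, hs =>
        by_contra hne
        have e0 : p t = p' t := ih t (by omega)
        have e1 : p (t + 1) = p' (t + 1) := ih (t + 1) (by omega)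
        have e2 : p (t + 2) = p' (t + 2) := ih (t + 2) (by omega)
        have a0 := hp.adj t (by omega)
        have a1 : X.Adj (p (t + 1)) (p (t + 2)) := hp.adj (t + 1) (by omega)
        have a2 : X.Adj (p (t + 2)) (p (t + 3)) := hp.adj (t + 2) (by omega)
        have a2' : X.Adj (p (t + 2)) (p' (t + 3)) := by
          rw [e2]
          exact hp'.adj (t + 2) (by omega)
        have n02 : p t ≠ p (t + 2) := fun heq => by
          have := hm.ear_injective h hc hp (by omega) (by omega) heq
          omega
        have n13 : p (t + 3) ≠ p (t + 1) := fun heq => by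
          have := hm.ear_injective h hc hp (by omega) (by omega) heq
          omega
        have n13' : p' (t + 3) ≠ p (t + 1) := fun heq => by
          rw [e1] at heq
          have := hm.ear_injective h hc hp' (by omega) (by omega) heq
          omega
        obtain ⟨z, hz1, hz2, hz⟩ := h.left.exists_third a0.symm a1 n02
        obtain ⟨e, he1, he2, he⟩ := h.left.exists_third a1.symm a2 n13.symm
        obtain rfl : e = p' (t + 3) := by
          rcases (he _).1 a2' with h3 | h3 | h3
          · exact absurd h3 n13'
          · exact absurd h3.symm hne
          · exact h3.symm
        have az : X.Adj (p (t + 1)) z := (hz z).2 (by simp)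
        obtain ⟨Z, hZ, hsw | hsw⟩ := h.exists_switch (u := p (t + 1)) (v := p (t + 2))
          (a := p t) (b := z) (c := p (t + 3)) (d := p' (t + 3)) a1.ne hz1.symm hne n02 hz2 n13
          n13' a0.symm az (fun h3 => h.no_triangle a1 h3 a2) (fun h3 => h.no_triangle a1 h3 a2')
          (fun h3 => h.no_triangle a1 a0.symm h3) (fun h3 => h.no_triangle a1 az h3) a2 a2'
          (fun w i1 i2 i3 i4 i5 i6 => by rw [hz, he]; grind)
        · rw [e0, e1, e2] at hsw
          exact hm.not_switch_ear h hZ hc hp' (by omega) hsw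
        · exact hm.not_switch_ear h hZ hc hp (by omega) hsw
  rw [← hp.finish, ← hp'.finish]
  exact key ℓ le_rfl ℓ le_rfl

/-- Of three shortest ears starting at the same vertex, two have the same end. -/
theorem Minimal.star (hm : Minimal V g ℓ) (h : Good X Y) (hc : Cyc X g c) {i j₁ j₂ j₃ : ℤ}
    (h1 : HasEar X c ℓ i j₁) (h2 : HasEar X c ℓ i j₂) (h3 : HasEar X c ℓ i j₃) :
    c j₁ = c j₂ ∨ c j₁ = c j₃ ∨ c j₂ = c j₃ := by
  obtain ⟨f, hf⟩ := hm.exists_third h hc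
  have key : ∀ {j p}, Ear X c ℓ i j p → p 1 = f i ∧ X.Adj (f i) (p 2) ∧ p 2 ≠ c i := by
    intro j p hp
    have h2 := hp.two_le
    have e1 : p 1 = f i := hf.eq_of_adj (hp.start ▸ hp.adj 0 (by omega))
      (hp.off 1 (by omega) (by omega))
    refine ⟨e1, e1 ▸ hp.adj 1 (by omega), fun heq => ?_⟩
    rw [← hp.start] at heq
    have := hm.ear_injective h hc hp (by omega) (by omega) heq
    omega
  obtain ⟨p₁, hp₁⟩ := h1
  obtain ⟨p₂, hp₂⟩ := h2
  obtain ⟨p₃, hp₃⟩ := h3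
  obtain ⟨k11, k12, k13⟩ := key hp₁
  obtain ⟨k21, k22, k23⟩ := key hp₂
  obtain ⟨k31, k32, k33⟩ := key hp₃
  by_cases h12 : p₁ 2 = p₂ 2
  · exact Or.inl (hm.ears_agree h hc hp₁ hp₂ (k11.trans k21.symm) h12)
  obtain ⟨e, -, -, he⟩ := h.left.exists_third (hf.adj i).symm k12 k13.symm
  have h2e : p₂ 2 = e := by
    rcases (he _).1 k22 with h | h | h
    · exact absurd h k23
    · exact absurd h.symm h12
    · exact h
  rcases (he _).1 k32 with h4 | h4 | h4
  · exact absurd h4 k33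
  · exact Or.inr (Or.inl (hm.ears_agree h hc hp₁ hp₃ (k11.trans k31.symm) h4.symm))
  · exact Or.inr (Or.inr (hm.ears_agree h hc hp₂ hp₃ (k21.trans k31.symm) (h2e.trans h4.symm)))

end Star

section Swap

variable {V : Type*} [Fintype V] [DecidableEq V] {X Y : SimpleGraph V} {g ℓ : ℕ} {c f : ℤ → V}

theorem Good.third_ne (h : Good X Y) (hc : Cyc X g c) (hf : Third X c f) {w : ℤ}
    (hw : w = 1 ∨ w = 2) (i : ℤ) : f i ≠ f (i + w) := by
  intro heq
  have h5 := h.five_le hc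
  have h1 := hf.adj i
  have h2 := hf.adj (i + w)
  rw [← heq] at h2
  rcases hw with rfl | rfl
  · exact h.no_triangle (hc.adj i) h1 h2
  · have h3 := hc.adj (i + 1)
    rw [add_assoc, one_add_one_eq_two] at h3
    refine h.no_square (u := c i) (v := c (i + 2)) (fun h0 => ?_) (hf.off i (i + 1)).symm
      (hc.adj i) h1 h3.symm h2
    have := hc.eq_of h0 (by omega) (by omega)
    omega

theorem Good.third_not_adj (h : Good X Y) (hc : Cyc X g c) (hf : Third X c f) {w : ℤ}
    (hw : w = 1 ∨ w = 2) (i : ℤ) : ¬ X.Adj (c i) (f (i + w)) ∧ ¬ X.Adj (c (i + w)) (f i) :=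
  ⟨fun h1 => h.third_ne hc hf hw i (hf.eq_of_adj h1 (hf.off _)).symm,
    fun h1 => h.third_ne hc hf hw i (hf.eq_of_adj h1 (hf.off _))⟩

theorem Good.exists_cycle_switch (h : Good X Y) (hc : Cyc X g c) (hf : Third X c f) {w : ℤ}
    (hw : w = 1 ∨ w = 2) (i : ℤ) : ∃ Z, Good Z X ∧
      (Switch X Z (c i) (c (i + w)) (c (i - 1)) (f i) (c (i + w + 1)) (f (i + w)) ∨
        Switch X Z (c i) (c (i + w)) (c (i - 1)) (f i) (f (i + w)) (c (i + w + 1))) := by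
  have h5 := h.five_le hc
  have hne : ∀ s t : ℤ, s < t → t < s + g → c s ≠ c t := fun s t h1 h2 heq => by
    have := hc.eq_of heq (by omega) (by omega)
    omega
  have hpred : ∀ s, c (s - 1) = c (s + g - 1) := fun s => by
    rw [← hc.periodic]
    congr 1
    ring
  have hna := h.third_not_adj hc hf hw i
  refine h.exists_switch (hne _ _ (by omega) (by omega)) (hf.off _ _).symm (hf.off _ _).symm
    (hne _ _ (by omega) (by omega)) (hf.off _ _) (hne _ _ (by omega) (by omega)).symm (hf.off _ _)
    (hc.adj_pred i) (hf.adj i) (hc.not_adj_of hf (by omega) (by omega)) hna.1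
    ?_ hna.2 (hc.adj _) (hf.adj _) ?_
  · rw [X.adj_comm]
    exact hc.not_adj_of hf (by omega) (by omega)
  · intro z h1 h2 h3 h4 h6 h7
    rw [hf.adj_iff, hf.adj_iff]
    have h8 : i + 1 = i + w ∨ i + 1 = i + w - 1 := by omega
    have h9 : i + w - 1 = i ∨ i + w - 1 = i + 1 := by omega
    rcases h8 with h8 | h8 <;> rcases h9 with h9 | h9 <;> rw [h9] <;> grind

theorem Minimal.not_switch_cycle (hm : Minimal V g ℓ) {Z : SimpleGraph V} (h : Good X Y)
    (hZ : Good Z X) (hc : Cyc X g c) (hf : Third X c f) {w : ℕ} (hw : w = 1 ∨ w = 2) {i : ℤ}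
    (hs : Switch X Z (c i) (c (i + w)) (c (i - 1)) (f i) (f (i + w)) (c (i + w + 1)))
    {ℓ' : ℕ} {j k : ℤ} (he : HasEar X c ℓ' k j) (hj : ∀ m : ℕ, m ≤ w → c j ≠ c (i + m)) :
    False := by
  have h5 := h.five_le hc
  have hne : ∀ s t : ℤ, s < t → t < s + g → c s ≠ c t := fun s t h1 h2 heq => by
    have := hc.eq_of heq (by omega) (by omega)
    omega
  have hpred : c (i - 1) = c (i + g - 1) := by
    rw [← hc.periodic]
    congr 1
    ring
  set d : ℤ → V := fun x => c (i + w + 1 + x % (g - w : ℕ)) with hd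
  have hcZ : Cyc Z (g - w) d := by
    refine hc.sub_cycle (by omega) (by omega) _ (fun r h1 h2 => ?_) ?_
    · by_cases h3 : r + 2 < (g - w : ℕ)
      · refine (hs.agree _ _ ?_ ?_ ?_ ?_).2 (hc.adj _) <;>
          exact (hne _ _ (by omega) (by omega)).symm
      · have e1 : c (i + w + 1 + r) = c (i - 1) := by
          rw [hpred]
          congr 1
          omega
        have e2 : c (i + w + 1 + r + 1) = c i := by
          rw [← hc.periodic i]
          congr 1
          omega
        rw [e1, e2]
        exact hs.Yua.symm
    · have e2 : c (i + w + 1 + ((g - w : ℕ) - 1)) = c i := by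
        rw [← hc.periodic i]
        congr 1
        omega
      rw [e2]
      exact hs.Yud
  have hout : ∀ y, (∀ m : ℕ, m ≤ w → c y ≠ c (i + m)) → ∃ x, d x = c y := by
    intro y hy
    have h1 : 0 ≤ (y - (i + w + 1)) % g := Int.emod_nonneg _ (by omega)
    have h2 : (y - (i + w + 1)) % g < g := Int.emod_lt_of_pos _ (by omega)
    have h3 : c (i + w + 1 + (y - (i + w + 1)) % g) = c y := by
      rw [hc.eq_iff]
      obtain ⟨q, hq⟩ := Int.dvd_self_sub_emod (x := y - (i + w + 1)) (m := g)
      exact ⟨-q, by linarith⟩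
    refine ⟨(y - (i + w + 1)) % g, ?_⟩
    rw [hd]
    simp only
    rw [Int.emod_eq_of_lt h1, h3]
    by_contra h4
    have h6 := hy ((y - (i + w + 1)) % g + w + 1 - g).toNat (by omega)
    apply h6
    rw [← h3, ← hc.periodic (i + _)]
    congr 1
    omega
  have hci : d ((g - w : ℕ) - 1) = c i := by
    rw [hd]
    simp only
    rw [Int.emod_eq_of_lt (by omega) (by omega), ← hc.periodic i]
    congr 1
    omega
  have hfree : ∀ y, (∀ k, y ≠ c k) → y ≠ c i ∧ y ≠ c (i + w) := fun y hy => ⟨hy _, hy _⟩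
  have hju : c j ≠ c i ∧ c j ≠ c (i + w) := by
    refine ⟨?_, hj w le_rfl⟩
    simpa using hj 0 (by omega)
  obtain ⟨y, hy⟩ := hout j hj
  obtain ⟨p, hp⟩ := he
  have hl := hp.two_le
  have hpne : ∀ t, 0 < t → t ≤ ℓ' → p t ≠ c i ∧ p t ≠ c (i + w) := by
    intro t h1 h2
    by_cases h3 : t = ℓ'
    · rw [h3, hp.finish]
      exact hju
    · exact hfree _ (hp.off t h1 (by omega))
  have hmid : ∀ t, 0 < t → t < ℓ' → Z.Adj (p t) (p (t + 1)) := fun t h1 h2 =>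
    (hs.agree _ _ (hpne t h1 (by omega)).1 (hpne t h1 (by omega)).2
      (hpne (t + 1) (by omega) (by omega)).1 (hpne (t + 1) (by omega) (by omega)).2).2 (hp.adj t h2)
  by_cases hk : ∀ m : ℕ, m ≤ w → c k ≠ c (i + m)
  · obtain ⟨x, hx⟩ := hout k hk
    have hku : c k ≠ c i ∧ c k ≠ c (i + w) := by
      refine ⟨?_, hk w le_rfl⟩
      simpa using hk 0 (by omega)
    refine hm.cycle Z X hZ (g - w) (by omega) d hcZ ℓ' x y ⟨p, hl, hp.start.trans hx.symm,
      hp.finish.trans hy.symm, by rw [hx, hy]; exact hp.ne, fun t ht => ?_,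
      fun t h1 h2 r => hp.off t h1 h2 _⟩
    rcases Nat.eq_zero_or_pos t with rfl | h0
    · have h1 := hpne 1 (by omega) (by omega)
      refine (hs.agree _ _ ?_ ?_ h1.1 h1.2).2 (hp.adj 0 ht) <;> rw [hp.start]
      · exact hku.1
      · exact hku.2
    · exact hmid t h0 ht
  · push Not at hk
    obtain ⟨m, hmw, hkm⟩ := hk
    have hp1 : p 1 = f (i + m) := hf.eq_of_adj (hkm ▸ hp.start ▸ hp.adj 0 (by omega))
      (hp.off 1 (by omega) (by omega))
    obtain ⟨M, hM1, hMw, hMadj⟩ : ∃ M : ℕ, 1 ≤ M ∧ M ≤ w ∧ Z.Adj (c (i + M)) (p 1) := by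
      by_cases h0 : m = 0
      · subst h0
        refine ⟨w, by omega, le_rfl, ?_⟩
        rw [hp1]
        simpa using hs.Yvb
      by_cases h1 : m = w
      · subst h1
        refine ⟨m, by omega, le_rfl, ?_⟩
        rw [hp1]
        exact hs.Yvc
      · refine ⟨m, by omega, hmw, ?_⟩
        have h2 := hpne 1 (by omega) (by omega)
        refine (hs.agree _ _ ?_ ?_ h2.1 h2.2).2 ?_
        · exact (hne _ _ (by omega) (by omega)).symm
        · exact hne _ _ (by omega) (by omega)
        · rw [hp1]
          exact hf.adj _
    refine hm.cycle Z X hZ (g - w) (by omega) d hcZ (ℓ' + M) ((g - w : ℕ) - 1) y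
      ⟨fun t => if t ≤ M then c (i + t) else p (t - M), by omega, by simp [hci], ?_, ?_, ?_, ?_⟩
    · simp only [show ¬ ℓ' + M ≤ M by omega, if_false, Nat.add_sub_cancel]
      rw [hp.finish, hy]
    · rw [hci, hy]
      exact hju.1.symm
    · intro t ht
      by_cases h1 : t < M
      · simp only [h1.le, show t + 1 ≤ M by omega, if_true]
        have := hs.middle_adj hc h5 (w := w) (by omega) (t := t)
          (by rw [hpred]; exact hne _ _ (by omega) (by omega)) (hf.off _ _).symm
          (hf.off _ _).symm (hne _ _ (by omega) (by omega)) (by omega) (by omega)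
        push_cast
        rwa [← add_assoc]
      by_cases h2 : t = M
      · subst h2
        simpa using hMadj
      · simp only [show ¬ t ≤ M by omega, show ¬ t + 1 ≤ M by omega, if_false]
        rw [show t + 1 - M = t - M + 1 by omega]
        exact hmid _ (by omega) (by omega)
    · intro t h1 h2 r
      by_cases h3 : t ≤ M
      · simp only [h3, if_true]
        have h6 : 0 ≤ r % (g - w : ℕ) := Int.emod_nonneg _ (by omega)
        have h7 : r % (g - w : ℕ) < (g - w : ℕ) := Int.emod_lt_of_pos _ (by omega)
        exact hne _ _ (by omega) (by omega)
      · simp only [h3, if_false]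
        exact hp.off _ (by omega) (by omega) _

end Swap

section ClosedPath

variable {V : Type*} {X Y : SimpleGraph V} {ℓ : ℕ}

/-- The cycles of length `ℓ + 1` in `X`, with a starting point and an orientation. -/
def ClosedPaths (X : SimpleGraph V) (ℓ : ℕ) : Set (ZMod (ℓ + 1) → V) :=
  {q | Function.Injective q ∧ ∀ t, X.Adj (q t) (q (t + 1))}

/-- The cyclic sequence `q` traverses the edge `xy`. -/
def Hits (q : ZMod (ℓ + 1) → V) (x y : V) : Prop :=
  ∃ t, q t = x ∧ q (t + 1) = y ∨ q t = y ∧ q (t + 1) = x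

theorem Hits.symm {q : ZMod (ℓ + 1) → V} {x y : V} (h : Hits q x y) : Hits q y x := by
  obtain ⟨t, ht⟩ := h
  exact ⟨t, ht.symm⟩

theorem Hits.adj {q : ZMod (ℓ + 1) → V} (hq : q ∈ ClosedPaths X ℓ) {x y : V} (h : Hits q x y) :
    X.Adj x y := by
  obtain ⟨t, ⟨rfl, rfl⟩ | ⟨rfl, rfl⟩⟩ := h
  · exact hq.2 t
  · exact (hq.2 t).symm

theorem Hits.comp {q : ZMod (ℓ + 1) → V} {x y : V} (h : Hits q x y) (e : V → V) :
    Hits (e ∘ q) (e x) (e y) := by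
  obtain ⟨t, ⟨rfl, rfl⟩ | ⟨rfl, rfl⟩⟩ := h
  · exact ⟨t, Or.inl ⟨rfl, rfl⟩⟩
  · exact ⟨t, Or.inr ⟨rfl, rfl⟩⟩

theorem Hits.exists_start {q : ZMod (ℓ + 1) → V} (hq : q ∈ ClosedPaths X ℓ) {x y : V}
    (h : Hits q x y) : ∃ q' ∈ ClosedPaths X ℓ, q' 0 = x ∧ q' 1 = y ∧
      ∀ x y, Hits q x y → Hits q' x y := by
  obtain ⟨t, ⟨rfl, rfl⟩ | ⟨rfl, rfl⟩⟩ := h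
  · refine ⟨fun s => q (t + s), ⟨fun a b hab => add_left_cancel (hq.1 hab), fun s => ?_⟩, by simp,
      rfl, ?_⟩
    · beta_reduce
      rw [← add_assoc]
      exact hq.2 _
    · rintro x y ⟨s, hs⟩
      refine ⟨s - t, ?_⟩
      beta_reduce
      rwa [show t + (s - t) = s by ring, show t + (s - t + 1) = s + 1 by ring]
  · refine ⟨fun s => q (t + 1 - s), ⟨fun a b hab => sub_right_injective (hq.1 hab), fun s => ?_⟩,
      by simp, by simp, ?_⟩
    · have := hq.2 (t + 1 - (s + 1))
      rw [show t + 1 - (s + 1) + 1 = t + 1 - s by ring] at this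
      exact this.symm
    · rintro x y ⟨s, hs⟩
      refine ⟨t - s, ?_⟩
      beta_reduce
      rw [show t + 1 - (t - s) = s + 1 by ring, show t + 1 - (t - s + 1) = s by ring]
      tauto

/-- The closed paths that use one of the edges `ub`, `vd` and one of the edges `ua`, `vc`. -/
def MixedPaths (X : SimpleGraph V) (ℓ : ℕ) (u v a b c d : V) : Set (ZMod (ℓ + 1) → V) :=
  {q ∈ ClosedPaths X ℓ | (Hits q u b ∨ Hits q v d) ∧ (Hits q u a ∨ Hits q v c)}

theorem Switch.adj_of_adj {u v a b c d : V} (h : Switch X Y u v a b c d) {x y : V}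
    (hxy : Y.Adj x y) (h1 : ¬ (x = u ∧ y = d)) (h2 : ¬ (y = u ∧ x = d)) (h3 : ¬ (x = v ∧ y = b))
    (h4 : ¬ (y = v ∧ x = b)) : X.Adj x y := by
  have key : ∀ x y, Y.Adj x y → ¬ (x = u ∧ y = d) → ¬ (x = v ∧ y = b) → (x = u ∨ x = v) →
      X.Adj x y := by
    rintro x y hxy h1 h2 (rfl | rfl)
    · by_cases hy : y = v
      · subst hy
        exact h.pair.1 hxy
      by_cases ha : y = a
      · subst ha
        exact h.Xua
      by_cases hb : y = b
      · subst hb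
        exact h.Xub
      by_cases hc : y = c
      · subst hc
        exact absurd hxy h.Yuc
      · exact (h.YXu y hxy.ne' hy ha hb hc (fun hd => h1 ⟨rfl, hd⟩)).1 hxy
    · by_cases hy : y = u
      · subst hy
        exact (h.pair.1 hxy.symm).symm
      by_cases ha : y = a
      · subst ha
        exact absurd hxy h.Yva
      by_cases hd : y = d
      · subst hd
        exact h.Xvd
      by_cases hc : y = c
      · subst hc
        exact h.Xvc
      · exact (h.YXv y hy hxy.ne' ha (fun hd => h2 ⟨rfl, hd⟩) hc hd).1 hxy
  by_cases hx : x = u ∨ x = v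
  · exact key x y hxy h1 h3 hx
  by_cases hy : y = u ∨ y = v
  · exact (key y x hxy.symm h2 h4 hy).symm
  · push Not at hx hy
    exact (h.agree x y hx.1 hx.2 hy.1 hy.2).1 hxy

theorem Switch.adj_swap_of_adj [DecidableEq V] {u v a b c d : V} (h : Switch X Y u v a b c d)
    {x y : V} (hxy : Y.Adj x y) (h1 : ¬ (x = u ∧ y = a)) (h2 : ¬ (y = u ∧ x = a))
    (h3 : ¬ (x = v ∧ y = c)) (h4 : ¬ (y = v ∧ x = c)) :
    X.Adj (Equiv.swap u v x) (Equiv.swap u v y) := by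
  have key : ∀ x y, Y.Adj x y → ¬ (x = u ∧ y = a) → ¬ (x = v ∧ y = c) → (x = u ∨ x = v) →
      X.Adj (Equiv.swap u v x) (Equiv.swap u v y) := by
    rintro x y hxy h1 h2 (rfl | rfl)
    · rw [Equiv.swap_apply_left]
      by_cases hy : y = v
      · subst hy
        rw [Equiv.swap_apply_right]
        exact (h.pair.1 hxy).symm
      rw [Equiv.swap_apply_of_ne_of_ne hxy.ne' hy]
      by_cases ha : y = a
      · exact absurd ⟨rfl, ha⟩ h1
      by_cases hb : y = b
      · subst hb
        exact absurd hxy h.Yub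
      by_cases hd : y = d
      · subst hd
        exact h.Xvd
      by_cases hc : y = c
      · subst hc
        exact h.Xvc
      · rw [← h.Xuv y hxy.ne' hy ha hb hc hd]
        exact (h.YXu y hxy.ne' hy ha hb hc hd).1 hxy
    · rw [Equiv.swap_apply_right]
      by_cases hy : y = u
      · subst hy
        rw [Equiv.swap_apply_left]
        exact h.pair.1 hxy.symm
      rw [Equiv.swap_apply_of_ne_of_ne hy hxy.ne']
      by_cases ha : y = a
      · subst ha
        exact h.Xua
      by_cases hb : y = b
      · subst hb
        exact h.Xub
      by_cases hd : y = d
      · subst hd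
        exact absurd hxy h.Yvd
      by_cases hc : y = c
      · exact absurd ⟨rfl, hc⟩ h2
      · rw [h.Xuv y hy hxy.ne' ha hb hc hd]
        exact (h.YXv y hy hxy.ne' ha hb hc hd).1 hxy
  by_cases hx : x = u ∨ x = v
  · exact key x y hxy h1 h3 hx
  by_cases hy : y = u ∨ y = v
  · exact (key y x hxy.symm h2 h4 hy).symm
  · push Not at hx hy
    rw [Equiv.swap_apply_of_ne_of_ne hx.1 hx.2, Equiv.swap_apply_of_ne_of_ne hy.1 hy.2]
    exact (h.agree x y hx.1 hx.2 hy.1 hy.2).1 hxy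

theorem Good.ncard_closedPaths [Fintype V] [DecidableEq V] (h : Good X Y)
    (hl : ℓ + 1 ≤ Fintype.card V - 2) :
    (ClosedPaths X ℓ).ncard = (ClosedPaths Y ℓ).ncard :=
  ncard_copies_eq (ι := ZMod (ℓ + 1)) (k := Fintype.card V - 2) rfl (Nat.sub_le _ _) h.deck
    (by rwa [ZMod.card]) fun K => ∀ t, K.Adj t (t + 1)

theorem Switch.mixedPaths_eq_empty [Fintype V] [DecidableEq V] {u v a b c d : V}
    (h : Switch X Y u v a b c d)
    (hcard : (ClosedPaths X ℓ).ncard = (ClosedPaths Y ℓ).ncard)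
    (hY : MixedPaths Y ℓ u v a d c b = ∅) : MixedPaths X ℓ u v a b c d = ∅ := by
  classical
  have hmix : ∀ q ∈ ClosedPaths Y ℓ, (Hits q u d ∨ Hits q v b) → ¬ Hits q u a ∧ ¬ Hits q v c := by
    intro q hq h1
    have : q ∉ MixedPaths Y ℓ u v a d c b := by simp [hY]
    rw [← not_or]
    exact fun h2 => this ⟨hq, h1, h2⟩
  let φ : (ZMod (ℓ + 1) → V) → (ZMod (ℓ + 1) → V) := fun q =>
    if Hits q u d ∨ Hits q v b then Equiv.swap u v ∘ q else q
  have hav := h.av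
  have hau := h.Xua.ne'
  have hbv := h.bv
  have hbu := h.Xub.ne'
  have hcu := h.cu
  have hcv := h.Xvc.ne'
  have hdu := h.du
  have hdv := h.Xvd.ne'
  have hback : ∀ (q : ZMod (ℓ + 1) → V) x y, Hits (Equiv.swap u v ∘ q) x y →
      Hits q (Equiv.swap u v x) (Equiv.swap u v y) := by
    intro q x y h1
    have h2 := h1.comp (Equiv.swap u v)
    have h3 : Equiv.swap u v ∘ Equiv.swap u v ∘ q = q := by
      ext t
      simp
    rwa [h3] at h2
  have hbu' : ∀ q : ZMod (ℓ + 1) → V, (Hits q u d ∨ Hits q v b) →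
      Hits (Equiv.swap u v ∘ q) v d ∨ Hits (Equiv.swap u v ∘ q) u b := by
    rintro q (h1 | h1)
    · left
      have := h1.comp (Equiv.swap u v)
      rwa [Equiv.swap_apply_left, Equiv.swap_apply_of_ne_of_ne hdu hdv] at this
    · right
      have := h1.comp (Equiv.swap u v)
      rwa [Equiv.swap_apply_right, Equiv.swap_apply_of_ne_of_ne hbu hbv] at this
  have hYn : ∀ q ∈ ClosedPaths Y ℓ, ¬ (Hits q v d ∨ Hits q u b) := by
    rintro q hq (h1 | h1)
    · exact h.Yvd (h1.adj hq)
    · exact h.Yub (h1.adj hq)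
  have hle : (ClosedPaths Y ℓ).ncard ≤
      (ClosedPaths X ℓ \ MixedPaths X ℓ u v a b c d).ncard := by
    refine Set.ncard_le_ncard_of_injOn φ ?_ ?_
    · intro q hq
      by_cases h1 : Hits q u d ∨ Hits q v b
      · have hn := hmix q hq h1
        simp only [φ, h1, if_true]
        refine ⟨⟨(Equiv.swap u v).injective.comp hq.1, fun t =>
          h.adj_swap_of_adj (hq.2 t) ?_ ?_ ?_ ?_⟩, ?_⟩
        · exact fun h2 => hn.1 ⟨t, Or.inl h2⟩
        · exact fun h2 => hn.1 ⟨t, Or.inr h2.symm⟩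
        · exact fun h2 => hn.2 ⟨t, Or.inl h2⟩
        · exact fun h2 => hn.2 ⟨t, Or.inr h2.symm⟩
        · rintro ⟨-, -, h2 | h2⟩
          · have := hback _ _ _ h2
            rw [Equiv.swap_apply_left, Equiv.swap_apply_of_ne_of_ne hau hav] at this
            exact h.Yva (this.adj hq)
          · have := hback _ _ _ h2
            rw [Equiv.swap_apply_right, Equiv.swap_apply_of_ne_of_ne hcu hcv] at this
            exact h.Yuc (this.adj hq)
      · simp only [φ, h1, if_false]
        push Not at h1
        refine ⟨⟨hq.1, fun t => h.adj_of_adj (hq.2 t) ?_ ?_ ?_ ?_⟩, ?_⟩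
        · exact fun h2 => h1.1 ⟨t, Or.inl h2⟩
        · exact fun h2 => h1.1 ⟨t, Or.inr h2.symm⟩
        · exact fun h2 => h1.2 ⟨t, Or.inl h2⟩
        · exact fun h2 => h1.2 ⟨t, Or.inr h2.symm⟩
        · rintro ⟨-, h2, -⟩
          exact hYn q hq h2.symm
    · intro q hq q' hq' heq
      by_cases h1 : Hits q u d ∨ Hits q v b <;> by_cases h2 : Hits q' u d ∨ Hits q' v b <;>
        simp only [φ, h1, h2, if_true, if_false] at heq
      · exact (Equiv.swap u v).injective.comp_left heq
      · exact absurd (heq ▸ hbu' q h1) (hYn q' hq')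
      · exact absurd (heq ▸ hbu' q' h2) (hYn q hq)
      · exact heq
  have hsub : MixedPaths X ℓ u v a b c d ⊆ ClosedPaths X ℓ := fun q hq => hq.1
  have := Set.ncard_sdiff_add_ncard_of_subset hsub
  rw [← Set.ncard_eq_zero]
  omega

end ClosedPath

section CycleSwitch

variable {V : Type*} [Fintype V] [DecidableEq V] {X Y : SimpleGraph V} {g ℓ : ℕ} {c : ℤ → V}
  {i : ℤ} {w : ℕ} {b d : V}

/-- A switch at the vertices `c i` and `c (i + w)` of a cycle `c` that keeps the cycle intact and
exchanges their neighbours `b` and `d` off the cycle. -/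
structure CycleSwitch (X Y : SimpleGraph V) (g : ℕ) (c : ℤ → V) (i : ℤ) (w : ℕ) (b d : V) :
    Prop where
  good : Good X Y
  width : w = 1 ∨ w = 2
  cyc_left : Cyc X g c
  cyc_right : Cyc Y g c
  switch : Switch X Y (c i) (c (i + w)) (c (i - 1)) b (c (i + w + 1)) d
  b_off : ∀ k, b ≠ c k
  d_off : ∀ k, d ≠ c k
  left_fst : ∀ z, X.Adj (c i) z → (∀ k, z ≠ c k) → z = b
  left_snd : ∀ z, X.Adj (c (i + w)) z → (∀ k, z ≠ c k) → z = d
  right_fst : ∀ z, Y.Adj (c i) z → (∀ k, z ≠ c k) → z = d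
  right_snd : ∀ z, Y.Adj (c (i + w)) z → (∀ k, z ≠ c k) → z = b

theorem CycleSwitch.symm (h : CycleSwitch X Y g c i w b d) :
    CycleSwitch Y X g c i w d b :=
  ⟨h.good.symm, h.width, h.cyc_right, h.cyc_left, h.switch.symm, h.d_off, h.b_off, h.right_fst,
    h.right_snd, h.left_fst, h.left_snd⟩

theorem Minimal.exists_cycleSwitch (hm : Minimal V g ℓ) {Z : SimpleGraph V} (h : Good X Z)
    (hc : Cyc X g c) (hw : w = 1 ∨ w = 2) (i : ℤ) {ℓ' : ℕ} {j k : ℤ} (he : HasEar X c ℓ' k j)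
    (hj : ∀ m : ℕ, m ≤ w → c j ≠ c (i + m)) : ∃ Y b d, CycleSwitch X Y g c i w b d := by
  have h5 := h.five_le hc
  have hne : ∀ s t : ℤ, s < t → t < s + g → c s ≠ c t := fun s t h1 h2 heq => by
    have := hc.eq_of heq (by omega) (by omega)
    omega
  have hpred : c (i - 1) = c (i + g - 1) := by
    rw [← hc.periodic]
    congr 1
    ring
  obtain ⟨f, hf⟩ := hm.exists_third h hc
  obtain ⟨Y, hY, hs | hs⟩ := h.exists_cycle_switch hc hf (w := w) (by omega) i
  swap
  · exact (hm.not_switch_cycle h hY hc hf hw hs he hj).elim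
  have hmid : ∀ t : ℤ, 0 ≤ t → t < w → Y.Adj (c (i + t)) (c (i + t + 1)) := fun t h1 h2 =>
    hs.middle_adj hc h5 (w := w) (by omega) (by rw [hpred]; exact hne _ _ (by omega) (by omega))
      (hf.off _ _).symm (hne _ _ (by omega) (by omega)) (hf.off _ _).symm h1 h2
  have hsucc : ∀ {s t : ℤ}, c s = c t → c (s + 1) = c (t + 1) ∧ c (s - 1) = c (t - 1) := by
    intro s t hst
    rw [hc.eq_iff] at hst ⊢
    rw [hc.eq_iff]
    exact ⟨by rwa [add_sub_add_right_eq_sub], by rwa [sub_sub_sub_cancel_right]⟩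
  have hcY : Cyc Y g c := by
    refine ⟨hc.three_le, hc.eq_iff, fun k => ?_⟩
    by_cases h1 : c k = c i
    · rw [h1, (hsucc h1).1]
      simpa using hmid 0 le_rfl (by omega)
    by_cases h2 : c k = c (i + w)
    · rw [h2, (hsucc h2).1]
      exact hs.Yvc
    by_cases h3 : c (k + 1) = c i
    · have := (hsucc h3).2
      rw [add_sub_cancel_right] at this
      rw [h3, this]
      exact hs.Yua.symm
    by_cases h4 : c (k + 1) = c (i + w)
    · have := (hsucc h4).2
      rw [add_sub_cancel_right] at this
      rw [h4, this]
      have := hmid (w - 1) (by omega) (by omega)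
      rwa [show i + ((w : ℤ) - 1) + 1 = i + w by ring, show i + ((w : ℤ) - 1) = i + w - 1 by ring]
        at this
    · exact (hs.agree _ _ h1 h2 h3 h4).2 (hc.adj k)
  obtain ⟨f', hf'⟩ := hm.exists_third hY hcY
  refine ⟨Y, f i, f (i + w), hY.symm, hw, hc, hcY, hs, hf.off _, hf.off _,
    fun z h1 h2 => hf.eq_of_adj h1 h2, fun z h1 h2 => hf.eq_of_adj h1 h2,
    fun z h1 h2 => ?_, fun z h1 h2 => ?_⟩
  · rw [hf'.eq_of_adj h1 h2, hf'.eq_of_adj hs.Yud (hf.off _)]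
  · rw [hf'.eq_of_adj h1 h2, hf'.eq_of_adj hs.Yvb (hf.off _)]

theorem CycleSwitch.hasEar (h : CycleSwitch X Y g c i w b d) {j : ℤ} (hj : c j ≠ c i)
    (hj' : c j ≠ c (i + w)) : (HasEar X c ℓ j i → HasEar Y c ℓ j (i + w)) ∧
      (HasEar X c ℓ j (i + w) → HasEar Y c ℓ j i) := by
  have key : ∀ k k', (k = i ∨ k = i + w) → c j ≠ c k' →
      (∀ z, (∀ m, z ≠ c m) → X.Adj (c k) z → Y.Adj (c k') z) →
      HasEar X c ℓ j k → HasEar Y c ℓ j k' := by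
    rintro k k' hk hjk hz ⟨p, hp⟩
    have h2 := hp.two_le
    have hout : ∀ t < ℓ, p t ≠ c i ∧ p t ≠ c (i + w) := by
      intro t ht
      rcases Nat.eq_zero_or_pos t with rfl | h0
      · rw [hp.start]
        exact ⟨hj, hj'⟩
      · exact ⟨hp.off t h0 ht _, hp.off t h0 ht _⟩
    refine ⟨fun t => if t < ℓ then p t else c k', h2, ?_, by simp, hjk, ?_, ?_⟩
    · simpa [show 0 < ℓ by omega] using hp.start
    · intro t ht
      by_cases h1 : t + 1 < ℓ
      · simp only [ht, h1, if_true]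
        exact (h.switch.agree _ _ (hout t ht).1 (hout t ht).2 (hout _ h1).1 (hout _ h1).2).2
          (hp.adj t ht)
      · simp only [ht, h1, if_true, if_false]
        have h3 := hp.adj t ht
        rw [show t + 1 = ℓ by omega, hp.finish] at h3
        exact (hz _ (hp.off t (by omega) ht) h3.symm).symm
    · intro t h1 h3
      simpa [h3] using hp.off t h1 h3
  refine ⟨key _ _ (Or.inl rfl) hj' fun z h1 h2 => ?_, key _ _ (Or.inr rfl) hj fun z h1 h2 => ?_⟩
  · rw [h.left_fst z h2 h1]
    exact h.switch.Yvb
  · rw [h.left_snd z h2 h1]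
    exact h.switch.Yud

theorem Minimal.closing_ear (hm : Minimal V g ℓ) (hX : Good X Y) (hc : Cyc X g c)
    {q : ZMod (ℓ + 1) → V} (hq : q ∈ ClosedPaths X ℓ) {k : ℤ} (h0 : q 0 = c k)
    (h1 : ∀ m, q 1 ≠ c m) {s t : ℤ} (hst : Hits q (c s) (c t)) :
    (c k = c s ∧ HasEar X c ℓ k t) ∨ (c k = c t ∧ HasEar X c ℓ k s) := by
  classical
  have hex : ∃ r : ℕ, 0 < r ∧ ∃ m, q (r : ZMod (ℓ + 1)) = c m :=
    ⟨ℓ + 1, by omega, k, by rw [ZMod.natCast_self, h0]⟩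
  obtain ⟨hr0, m, hrm⟩ := Nat.find_spec hex
  have hmin : ∀ r', 0 < r' → r' < Nat.find hex → ∀ m, q (r' : ZMod (ℓ + 1)) ≠ c m := by
    intro r' h2 h3 m h4
    exact Nat.find_min hex h3 ⟨h2, m, h4⟩
  have hle : Nat.find hex ≤ ℓ + 1 := Nat.find_min' hex ⟨by omega, k, by
    rw [ZMod.natCast_self, h0]⟩
  generalize Nat.find hex = r at hr0 hrm hmin hle
  have hval : ∀ x : ZMod (ℓ + 1), ∃ n : ℕ, n < ℓ + 1 ∧ (n : ZMod (ℓ + 1)) = x := fun x =>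
    ⟨x.val, ZMod.val_lt x, ZMod.natCast_zmod_val x⟩
  have hinj : ∀ n n' : ℕ, n < ℓ + 1 → n' < ℓ + 1 → (n : ZMod (ℓ + 1)) = n' → n = n' := by
    intro n n' h2 h3 h4
    have := congrArg ZMod.val h4
    rwa [ZMod.val_natCast_of_lt h2, ZMod.val_natCast_of_lt h3] at this
  have hr1 : r ≠ 1 := by
    rintro rfl
    exact h1 m (by simpa using hrm)
  have hsC : ∃ x, q x = c s := by
    obtain ⟨x, h | h⟩ := hst
    · exact ⟨_, h.1⟩
    · exact ⟨_, h.2⟩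
  have htC : ∃ x, q x = c t := by
    obtain ⟨x, h | h⟩ := hst
    · exact ⟨_, h.2⟩
    · exact ⟨_, h.1⟩
  have hne : c s ≠ c t := (hst.adj hq).ne
  obtain ⟨x, hx⟩ := hsC
  obtain ⟨y, hy⟩ := htC
  have hxy : x ≠ y := by
    rintro rfl
    exact hne (hx.symm.trans hy)
  obtain ⟨nx, hnx, rfl⟩ := hval x
  obtain ⟨ny, hny, rfl⟩ := hval y
  have hbig : ∀ n : ℕ, n < ℓ + 1 → (∃ m, q n = c m) → n = 0 ∨ r ≤ n := by
    rintro n hn ⟨m, hm⟩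
    by_contra! h
    exact hmin n (by omega) h.2 m hm
  have hr : r < ℓ + 1 := by
    by_contra hge
    have hx0 := hbig nx hnx ⟨_, hx⟩
    have hy0 := hbig ny hny ⟨_, hy⟩
    exact hxy (by rw [show nx = ny by omega])
  have hear : Ear X c r k m fun n => q (n : ZMod (ℓ + 1)) := by
    refine ⟨by omega, by simpa using h0, hrm, ?_, fun n _ => ?_, hmin⟩
    · rw [← h0, ← hrm]
      intro h
      have := hinj 0 r (by omega) hr (by simpa using hq.1 h)
      omega
    · push_cast
      exact hq.2 _
  have hrl : r = ℓ := by
    by_contra h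
    exact hm.ear X Y hX c hc r (by omega) k m ⟨_, hear⟩
  subst hrl
  have hx0 := hbig nx hnx ⟨_, hx⟩
  have hy0 := hbig ny hny ⟨_, hy⟩
  have hxy' : nx ≠ ny := fun h => hxy (by rw [h])
  have hear' : HasEar X c r k m := ⟨_, hear⟩
  rcases hx0 with rfl | hx0
  · left
    obtain rfl : ny = r := by omega
    refine ⟨?_, hear'.congr rfl (hrm.symm.trans hy)⟩
    rw [← h0, ← hx, Nat.cast_zero]
  · right
    obtain rfl : nx = r := by omega
    obtain rfl : ny = 0 := by omega
    refine ⟨?_, hear'.congr rfl (hrm.symm.trans hx)⟩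
    rw [← h0, ← hy, Nat.cast_zero]

theorem Minimal.exists_closedPath (hm : Minimal V g ℓ) (hX : Good X Y) (hc : Cyc X g c)
    {j k : ℤ} (hjk : X.Adj (c j) (c k)) {z : V} (hz : ∀ y, X.Adj (c j) y → (∀ m, y ≠ c m) → y = z)
    (he : HasEar X c ℓ j k) : ∃ q ∈ ClosedPaths X ℓ, Hits q (c j) z ∧ Hits q (c j) (c k) := by
  obtain ⟨p, hp⟩ := he
  have h2 := hp.two_le
  have hval : ∀ t : ZMod (ℓ + 1),
      t.val < ℓ ∧ (t + 1).val = t.val + 1 ∨ t.val = ℓ ∧ (t + 1).val = 0 := by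
    intro t
    have h1 := ZMod.val_lt t
    have h3 : (t + 1).val = (t.val + 1) % (ℓ + 1) := by
      rw [← ZMod.val_natCast]
      push_cast
      rw [ZMod.natCast_zmod_val]
    rcases Nat.lt_or_ge t.val ℓ with h | h
    · exact Or.inl ⟨h, by rw [h3, Nat.mod_eq_of_lt (by omega)]⟩
    · have h4 : t.val = ℓ := by omega
      exact Or.inr ⟨h4, by rw [h3, h4, Nat.mod_self]⟩
  have hv : ∀ n : ℕ, n < ℓ + 1 → (n : ZMod (ℓ + 1)).val = n := fun n h => ZMod.val_natCast_of_lt h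
  refine ⟨fun t => p t.val, ⟨fun s t hst => ?_, fun t => ?_⟩, ⟨0, Or.inl ⟨?_, ?_⟩⟩,
    ⟨(ℓ : ℕ), Or.inr ⟨?_, ?_⟩⟩⟩
  · exact ZMod.val_injective _ (hm.ear_injective hX hc hp (by have := ZMod.val_lt s; omega)
      (by have := ZMod.val_lt t; omega) hst)
  · rcases hval t with ⟨h3, h4⟩ | ⟨h3, h4⟩
    · simp only [h4]
      exact hp.adj _ h3
    · simp only [h3, h4]
      rw [hp.start, hp.finish]
      exact hjk.symm
  · simpa using hp.start
  · have h3 := hv 1 (by omega)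
    rw [Nat.cast_one] at h3
    rw [zero_add]
    simp only [h3]
    exact hz _ (hp.start ▸ hp.adj 0 (by omega)) (hp.off 1 (by omega) (by omega))
  · simp only [hv ℓ (by omega)]
    exact hp.finish
  · rcases hval (ℓ : ℕ) with ⟨h3, h4⟩ | ⟨h3, h4⟩
    · rw [hv ℓ (by omega)] at h3
      omega
    · simp only [h4]
      exact hp.start

theorem CycleSwitch.mixedPaths_nonempty_iff (hm : Minimal V g ℓ)
    (h : CycleSwitch X Y g c i w b d) :
    (MixedPaths X ℓ (c i) (c (i + w)) (c (i - 1)) b (c (i + w + 1)) d).Nonempty ↔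
      HasEar X c ℓ i (i - 1) ∨ HasEar X c ℓ (i + w) (i + w + 1) := by
  have hs := h.switch
  have hn : c (i + w) ≠ c (i - 1) := hs.av.symm
  have hn' : c i ≠ c (i + w + 1) := hs.cu.symm
  have hn2 := hs.ne
  constructor
  · rintro ⟨q, hq, h1, h2⟩
    obtain ⟨q', hq', h0, h1, hh⟩ | ⟨q', hq', h0, h1, hh⟩ := h1.imp (·.exists_start hq)
      (·.exists_start hq)
    · left
      rcases h2 with h2 | h2
      · rcases hm.closing_ear h.good h.cyc_left hq' h0 (h1 ▸ h.b_off) (hh _ _ h2) with h3 | h3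
        · exact h3.2
        · exact absurd h3.1.symm (h.cyc_left.adj_pred i).ne'
      · rcases hm.closing_ear h.good h.cyc_left hq' h0 (h1 ▸ h.b_off) (hh _ _ h2) with h3 | h3
        · exact absurd h3.1 hn2
        · exact absurd h3.1 hn'
    · right
      rcases h2 with h2 | h2
      · rcases hm.closing_ear h.good h.cyc_left hq' h0 (h1 ▸ h.d_off) (hh _ _ h2) with h3 | h3
        · exact absurd h3.1.symm hn2
        · exact absurd h3.1 hn
      · rcases hm.closing_ear h.good h.cyc_left hq' h0 (h1 ▸ h.d_off) (hh _ _ h2) with h3 | h3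
        · exact h3.2
        · exact absurd h3.1 (h.cyc_left.adj (i + w)).ne
  · rintro (h1 | h1)
    · obtain ⟨q, hq, h2, h3⟩ := hm.exists_closedPath h.good h.cyc_left (h.cyc_left.adj_pred i)
        h.left_fst h1
      exact ⟨q, hq, Or.inl h2, Or.inl h3⟩
    · obtain ⟨q, hq, h2, h3⟩ := hm.exists_closedPath h.good h.cyc_left (h.cyc_left.adj (i + w))
        h.left_snd h1
      exact ⟨q, hq, Or.inr h2, Or.inr h3⟩

theorem CycleSwitch.hasEar_transfer (hm : Minimal V g ℓ) (h : CycleSwitch X Y g c i w b d)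
    (he : HasEar X c ℓ i (i - 1) ∨ HasEar X c ℓ (i + w) (i + w + 1)) :
    HasEar Y c ℓ i (i - 1) ∨ HasEar Y c ℓ (i + w) (i + w + 1) := by
  have hl : ℓ + 1 ≤ Fintype.card V - 2 := by
    obtain ⟨p, hp⟩ | ⟨p, hp⟩ := he <;> exact hm.ear_card h.good h.cyc_left hp
  rw [← h.mixedPaths_nonempty_iff hm] at he
  rw [← h.symm.mixedPaths_nonempty_iff hm]
  by_contra hY
  rw [Set.not_nonempty_iff_eq_empty] at hY
  rw [h.switch.mixedPaths_eq_empty (h.good.ncard_closedPaths hl) hY] at he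
  exact Set.not_nonempty_empty he

theorem CycleSwitch.hasEar_cross (hm : Minimal V g ℓ) (h : CycleSwitch X Y g c i w b d) :
    HasEar X c ℓ i (i - 1) ∨ HasEar X c ℓ (i + w) (i + w + 1) ↔
      HasEar X c ℓ (i - 1) (i + w) ∨ HasEar X c ℓ (i + w + 1) i := by
  have hs := h.switch
  have hn : c (i - 1) ≠ c (i + w) := hs.av
  have hn' : c (i + w + 1) ≠ c i := hs.cu
  have h1 : c (i - 1) ≠ c i := (h.cyc_left.adj_pred i).ne'
  have h2 : c (i + w + 1) ≠ c (i + w) := (h.cyc_left.adj _).ne'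
  constructor
  · intro he
    exact (h.hasEar_transfer hm he).imp (fun e => (h.symm.hasEar h1 hn).1 e.symm)
      (fun e => (h.symm.hasEar hn' h2).2 e.symm)
  · intro he
    refine h.symm.hasEar_transfer hm (he.imp (fun e => ?_) fun e => ?_)
    · exact ((h.hasEar h1 hn).2 e).symm
    · exact ((h.hasEar hn' h2).1 e).symm

/-- Exchange of shortest ears around the arc from `c i` to `c (i + w)`. -/
theorem Minimal.cross (hm : Minimal V g ℓ) (h : Good X Y) (hc : Cyc X g c) (hw : w = 1 ∨ w = 2)
    (i : ℤ) {j k : ℤ} (he : HasEar X c ℓ k j) (hj : ∀ m : ℕ, m ≤ w → c j ≠ c (i + m)) :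
    HasEar X c ℓ i (i - 1) ∨ HasEar X c ℓ (i + w) (i + w + 1) ↔
      HasEar X c ℓ (i - 1) (i + w) ∨ HasEar X c ℓ (i + w + 1) i := by
  obtain ⟨Z, b, d, hs⟩ := hm.exists_cycleSwitch h hc hw i he hj
  exact hs.hasEar_cross hm

end CycleSwitch

/-- No symmetric relation on `ℤ / g` with at most two related elements per element, some
consecutive related elements, and the crossing rule for ears. -/
theorem not_of_cross {g : ℤ} (hg : 5 ≤ g) {E : ℤ → ℤ → Prop} (symm : ∀ {a b}, E a b → E b a)
    (shift : ∀ {a b}, E a b → E a (b + g))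
    (star : ∀ i {a b c : ℤ}, a < b → b < c → c < a + g → E i a → E i b → ¬ E i c)
    (cross : ∀ w : ℕ, w = 1 ∨ w = 2 → ∀ i j k : ℤ, E k j → i + w < j → j < i + g →
      (E i (i - 1) ∨ E (i + w) (i + w + 1) ↔ E (i - 1) (i + w) ∨ E (i + w + 1) i)) :
    ¬ E 0 1 := by
  intro h
  have h1g : E 1 g := by simpa using shift (symm h)
  have hA : E 0 2 ∨ E 3 1 := by
    simpa [symm h] using (cross 1 (.inl rfl) 1 g 1 h1g (by simpa using by omega) (by omega)).1
  have hB : E (-2) 0 ∨ E 1 (-1) := by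
    simpa [h] using (cross 1 (.inl rfl) (-1) 1 0 h (by simp) (by omega)).1
  have hC : E 0 3 ∨ E 4 1 := by
    simpa [symm h] using (cross 2 (.inr rfl) 1 g 1 h1g (by simpa using by omega) (by omega)).1
  rcases hA with hA | hA <;> rcases hB with hB | hB
  · exact star 0 (by omega) (by omega) (by omega) (symm hB) h hA
  · have h03 : ¬ E 0 3 := star 0 (by omega) (by omega) (by omega) h hA
    have h14 := symm (hC.resolve_left h03)
    obtain rfl : g = 5 := by
      by_contra h5
      exact star 1 (by omega) (by omega) (by omega) hB (symm h) h14
    have h0 : E 0 (-1) ∨ E 1 2 := by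
      simpa [symm hA] using (cross 1 (.inl rfl) 0 2 0 hA (by simp) (by omega)).2
    rcases h0 with h0 | h0
    · exact star 0 (by omega) (by omega) (by omega) h0 h hA
    · exact star 1 (by omega) (by omega) (by omega) hB (symm h) h0
  · have h14 : ¬ E 1 4 := star 1 (by omega) (by omega) (by omega) (symm h) (symm hA)
    have h03 := hC.resolve_right fun h' => h14 (symm h')
    obtain rfl : g = 5 := by
      by_contra h5
      exact star 0 (by omega) (by omega) (by omega) (symm hB) h h03
    have h2 : E 2 1 ∨ E 3 4 := by
      simpa [symm hA] using (cross 1 (.inl rfl) 2 5 1 h1g (by simp) (by omega)).2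
    have h34 := h2.resolve_left fun h' =>
      star 1 (by omega) (by omega) (by omega) (symm h) (symm h') (symm hA)
    have h53 : E 5 3 := symm (by simpa using shift (symm h03))
    have h3 : E 3 2 ∨ E 4 5 := by
      simpa [h53] using (cross 1 (.inl rfl) 3 5 1 h1g (by simp) (by omega)).2
    rcases h3 with h3 | h3
    · exact star 3 (by omega) (by omega) (by omega) hA h3 h34
    · have h56 : E 5 6 := by simpa using shift (symm h1g)
      exact star 5 (by omega) (by omega) (by omega) h53 (symm h3) h56
  · exact star 1 (by omega) (by omega) (by omega) hB (symm h) (symm hA)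

section Minimal

variable {V : Type*} [Fintype V] [DecidableEq V] {X Y : SimpleGraph V} {g ℓ : ℕ} {c : ℤ → V}

theorem Minimal.not_hasEar_succ (hm : Minimal V g ℓ) (h : Good X Y) (hc : Cyc X g c) (n : ℤ) :
    ¬ HasEar X c ℓ n (n + 1) := by
  have h5 := h.five_le hc
  intro he
  refine not_of_cross (g := g) (by omega) (E := fun a b => HasEar X c ℓ (n + a) (n + b))
    (fun h => h.symm) (fun {a b} he => ?_) (fun i a b d hab hbd hda h1 h2 h3 => ?_)
    (fun w hw i j k he h1 h2 => ?_) (by simpa using he)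
  · refine he.congr rfl ?_
    rw [← add_assoc, hc.periodic]
  · rcases hm.star h hc h1 h2 h3 with h | h | h <;>
    · have := hc.eq_of h (by omega) (by omega)
      omega
  · have := hm.cross h hc hw (n + i) he fun m hmw heq => by
      have := hc.eq_of heq (by omega) (by omega)
      omega
    simpa only [add_assoc, add_sub_assoc] using this

theorem Minimal.not_hasEar_add (hm : Minimal V g ℓ) {s : ℕ} (hs : 1 ≤ s) (hsg : s < g)
    (h : Good X Y) (hc : Cyc X g c) (n : ℤ) : ¬ HasEar X c ℓ n (n + s) := by
  induction s, hs using Nat.le_induction generalizing X Y with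
  | base => simpa using hm.not_hasEar_succ h hc n
  | succ s hs ih =>
    intro he
    have hne : ∀ m : ℕ, m ≤ 1 → c n ≠ c (n + s + m) := fun m hm1 heq => by
      have := hc.eq_of heq (by omega) (by omega)
      omega
    obtain ⟨Z, b, d, hZ⟩ := hm.exists_cycleSwitch h hc (.inl rfl) (n + s) he.symm hne
    refine ih (by omega) hZ.good.symm hZ.cyc_right
      ((hZ.hasEar (by simpa using hne 0 (by omega)) (hne 1 le_rfl)).2 ?_)
    simpa [add_assoc] using he

theorem Minimal.not_hasEar (hm : Minimal V g ℓ) (h : Good X Y) (hc : Cyc X g c) (i j : ℤ) :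
    ¬ HasEar X c ℓ i j := by
  intro he
  have h5 := h.five_le hc
  have h1 : 0 ≤ (j - i) % g := Int.emod_nonneg _ (by omega)
  have h2 : (j - i) % g < g := Int.emod_lt_of_pos _ (by omega)
  have hij : c j = c (i + ((j - i) % g).toNat) := by
    rw [hc.eq_iff, Int.toNat_of_nonneg h1, ← sub_sub]
    exact Int.dvd_self_sub_emod
  refine hm.not_hasEar_add (s := ((j - i) % g).toNat) ?_ (by omega) h hc i (he.congr rfl hij)
  by_contra h0
  obtain ⟨p, hp⟩ := he
  refine hp.ne ?_
  rw [hij, show ((j - i) % g).toNat = 0 by omega]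
  simp

/-- Cubic graphs with the same `(n - 2)`-deck are isomorphic. -/
theorem Good.false [Nonempty V] (h : Good X Y) : False := by
  classical
  have hex : ∃ g, ∃ X Y : SimpleGraph V, Good X Y ∧ ∃ c, Cyc X g c ∧ ∃ ℓ i j, HasEar X c ℓ i j := by
    obtain ⟨g, c, ℓ, i, j, hc, he⟩ := h.left.exists_cyc_ear
    exact ⟨g, X, Y, h, c, hc, ℓ, i, j, he⟩
  obtain ⟨X₁, Y₁, h₁, c₁, hc₁, ℓ₁, i₁, j₁, he₁⟩ := Nat.find_spec hex
  have hex' : ∃ ℓ, ∃ X Y : SimpleGraph V, Good X Y ∧ ∃ c, Cyc X (Nat.find hex) c ∧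
      ∃ i j, HasEar X c ℓ i j :=
    ⟨ℓ₁, X₁, Y₁, h₁, c₁, hc₁, i₁, j₁, he₁⟩
  obtain ⟨X₂, Y₂, h₂, c₂, hc₂, i₂, j₂, he₂⟩ := Nat.find_spec hex'
  exact Minimal.not_hasEar (g := Nat.find hex) (ℓ := Nat.find hex')
    ⟨fun X Y h g' hg' c hc ℓ' i j he => Nat.find_min hex hg' ⟨X, Y, h, c, hc, ℓ', i, j, he⟩,
      fun X Y h c hc ℓ' hℓ' i j he => Nat.find_min hex' hℓ' ⟨X, Y, h, c, hc, i, j, he⟩⟩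
    h₂ hc₂ i₂ j₂ he₂

end Minimal

theorem Cubic.of_isRegularOfDegree {V : Type*} {G : SimpleGraph V} [G.LocallyFinite]
    (h : G.IsRegularOfDegree 3) : Cubic G := fun v => by
  rw [← Nat.card_coe_set_eq, Nat.card_eq_fintype_card, card_neighborSet_eq_degree, h v]

section Degree

variable {V : Type*} [Fintype V]

theorem ncard_copies_edge (X : SimpleGraph V) :
    (Copies X fun Q : SimpleGraph (Fin 2) => Q.Adj 0 1).ncard = ∑ v, (X.neighborSet v).ncard := by
  simp_rw [← Nat.card_coe_set_eq]
  rw [← Nat.card_sigma]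
  refine Nat.card_congr
    { toFun := fun q => ⟨q.1 0, q.1 1, q.2.2⟩
      invFun := fun s => ⟨![s.1, s.2.1], ?_, ?_⟩
      left_inv := ?_
      right_inv := fun s => rfl }
  · have := s.2.2.ne
    intro x y hxy
    fin_cases x <;> fin_cases y <;> simp_all
  · exact s.2.2
  · intro q
    ext x
    fin_cases x <;> rfl

theorem ncard_copies_cherry (X : SimpleGraph V) :
    (Copies X fun Q : SimpleGraph (Fin 3) => Q.Adj 0 1 ∧ Q.Adj 0 2).ncard =
      ∑ v, (X.neighborSet v).offDiag.ncard := by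
  simp_rw [← Nat.card_coe_set_eq]
  rw [← Nat.card_sigma]
  refine Nat.card_congr
    { toFun := fun q => ⟨q.1 0, (q.1 1, q.1 2), q.2.2.1, q.2.2.2, fun h => ?_⟩
      invFun := fun s => ⟨![s.1, s.2.1.1, s.2.1.2], ?_, ?_⟩
      left_inv := ?_
      right_inv := fun s => rfl }
  · exact absurd (q.2.1 h) (by decide)
  · have h1 := s.2.2.1.ne
    have h2 := s.2.2.2.1.ne
    have h3 := s.2.2.2.2
    intro x y hxy
    fin_cases x <;> fin_cases y <;> simp_all
  · exact ⟨s.2.2.1, s.2.2.2.1⟩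
  · intro q
    ext x
    fin_cases x <;> rfl

theorem ncard_offDiag_neighborSet (X : SimpleGraph V) (v : V) :
    (X.neighborSet v).offDiag.ncard + (X.neighborSet v).ncard = (X.neighborSet v).ncard ^ 2 := by
  classical
  rw [Set.ncard_eq_toFinset_card', Set.ncard_eq_toFinset_card', Set.toFinset_offDiag,
    Finset.offDiag_card, sq]
  exact Nat.sub_add_cancel (Nat.le_mul_self _)

theorem Cubic.four_le_card [Nonempty V] {X : SimpleGraph V} (hX : Cubic X) :
    4 ≤ Fintype.card V := by
  obtain ⟨v⟩ := ‹Nonempty V›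
  have h : (insert v (X.neighborSet v)).ncard = 4 := by
    rw [Set.ncard_insert_of_notMem (by simp), hX]
  rw [← h, ← Nat.card_eq_fintype_card]
  exact Set.ncard_le_card _

variable [DecidableEq V] {X Y : SimpleGraph V}

theorem Cubic.of_sameDeck (hX : Cubic X) (h4 : 4 ≤ Fintype.card V)
    (hd : SameDeck X Y (Fintype.card V - 2)) : Cubic Y := by
  have h1 := ncard_copies_eq rfl (Nat.sub_le _ _) hd (by simp; omega)
    fun Q : SimpleGraph (Fin 2) => Q.Adj 0 1
  rw [ncard_copies_edge, ncard_copies_edge] at h1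
  simp only [hX _] at h1
  rcases h4.eq_or_lt with h4 | h5
  · have hle : ∀ v ∈ Finset.univ, (Y.neighborSet v).ncard ≤ 3 := fun v _ => by
      have := Set.ncard_le_card (insert v (Y.neighborSet v))
      rw [Set.ncard_insert_of_notMem (by simp), Nat.card_eq_fintype_card] at this
      omega
    intro v
    exact (Finset.sum_eq_sum_iff_of_le hle).1 h1.symm v (Finset.mem_univ v)
  · have h2 := ncard_copies_eq rfl (Nat.sub_le _ _) hd (by simp; omega)
      fun Q : SimpleGraph (Fin 3) => Q.Adj 0 1 ∧ Q.Adj 0 2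
    rw [ncard_copies_cherry, ncard_copies_cherry] at h2
    have h3 : ∑ v, (X.neighborSet v).ncard ^ 2 = ∑ v, (Y.neighborSet v).ncard ^ 2 := by
      simp_rw [← ncard_offDiag_neighborSet, Finset.sum_add_distrib]
      simp only [hX _]
      rw [h1, h2]
    simp only [hX _] at h3
    have h0 : ∑ v, (((Y.neighborSet v).ncard : ℤ) - 3) ^ 2 = 0 := by
      zify at h1 h3
      have : ∀ v, (((Y.neighborSet v).ncard : ℤ) - 3) ^ 2 =
        ((Y.neighborSet v).ncard : ℤ) ^ 2 - 6 * (Y.neighborSet v).ncard + 9 := fun v => by ring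
      simp_rw [this, Finset.sum_add_distrib, Finset.sum_sub_distrib, ← Finset.mul_sum, ← h1, ← h3]
      simp
      ring
    intro v
    have := (Finset.sum_eq_zero_iff_of_nonneg fun v _ => sq_nonneg _).1 h0 v (Finset.mem_univ v)
    have := pow_eq_zero_iff (two_ne_zero) |>.1 this
    omega

end Degree

end CubicReconstruction

/-- Every 3-regular graph is 2-reconstructible. -/
theorem three_regular_two_reconstructible
    {V W : Type*} [Fintype V] [Fintype W] [DecidableEq V] [DecidableEq W]
    (G : SimpleGraph V) (H : SimpleGraph W) [DecidableRel G.Adj]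
    (hreg : G.IsRegularOfDegree 3) (hcard : Fintype.card W = Fintype.card V)
    (hdeck : SameDeck G H (Fintype.card V - 2)) : Nonempty (G ≃g H) := by
  let e : V ≃ W := (Fintype.equivOfCardEq hcard).symm
  rcases isEmpty_or_nonempty V with hV | hV
  · exact ⟨e, fun {x} => hV.elim x⟩
  let f : H.comap e ≃g H := SimpleGraph.Iso.comap e H
  have hd : SameDeck G (H.comap e) (Fintype.card V - 2) :=
    CubicReconstruction.sameDeck_trans_iso hdeck f.symm
  by_contra hne
  have hG := CubicReconstruction.Cubic.of_isRegularOfDegree hreg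
  exact CubicReconstruction.Good.false (X := G) (Y := H.comap e)
    ⟨hG, hG.of_sameDeck hG.four_le_card hd, hd, ⟨fun i => hne ⟨i.trans f⟩⟩⟩
end

section
/- (Kelly's Lemma) Let G and H be finite simple graphs on n vertices having the same k-deck, where 1 ≤ k ≤ n. Then for every finite simple graph F with at most k vertices, the number of subgraphs of G isomorphic to F equals the number of subgraphs of H isomorphic to F. -/
open SimpleGraph

open Finset in
/-- The number of `k`-element sets containing a given set with at most `k` elements. -/
lemma card_supersets_of_card_eq {V : Type*} [Fintype V] (t : Set V) {k : ℕ}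
    (ht : Nat.card t ≤ k) :
    Nat.card {s : {s : Finset V // s.card = k} // t ⊆ (s.1 : Set V)} =
      (Fintype.card V - Nat.card t).choose (k - Nat.card t) := by
  classical
  have htc : #t.toFinset = Nat.card t := by simp [Nat.card_eq_fintype_card]
  rw [← htc, ← card_univ,
    ← card_filter_powersetCard_subset t.toFinset univ k (subset_univ _) (htc ▸ ht),
    ← Nat.card_eq_finsetCard]
  refine Nat.card_congr ((Equiv.subtypeSubtypeEquivSubtypeInter _
    fun s : Finset V ↦ t ⊆ (s : Set V)).trans (Equiv.subtypeEquivRight fun s ↦ ?_))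
  simp [mem_powersetCard, Set.toFinset_subset]

namespace SimpleGraph

/-- The image of a graph embedding `f : A ↪g G` identifies the subgraphs of `A` isomorphic to `F`
with the subgraphs of `G` isomorphic to `F` whose vertices lie in the range of `f`. -/
lemma card_subgraph_iso_eq_of_embedding {α V U : Type*} {A : SimpleGraph α} {G : SimpleGraph V}
    (F : SimpleGraph U) (f : A ↪g G) :
    Nat.card {A' : A.Subgraph // Nonempty (A'.coe ≃g F)} =
      Nat.card {G' : G.Subgraph // Nonempty (G'.coe ≃g F) ∧ G'.verts ⊆ Set.range f} := by
  refine Nat.card_congr (Equiv.ofBijective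
    (fun A' ↦ ⟨A'.1.map f.toHom,
      ⟨(f.toCopy.isoSubgraphMap A'.1).symm.trans A'.2.some⟩, ?_⟩) ⟨?_, ?_⟩)
  · rintro _ ⟨a, -, rfl⟩
    exact ⟨a, rfl⟩
  · intro A₁ A₂ h
    have h' : ∀ A' : A.Subgraph, (A'.map f.toHom).comap f.toHom = A' := by
      intro A'
      ext x y
      · simp
      · simpa [Relation.map_apply] using fun h ↦ A'.adj_sub h
    have h₁ := congrArg (fun B ↦ Subgraph.comap f.toHom B.1) h
    simp only [h'] at h₁
    exact Subtype.ext h₁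
  · rintro ⟨G', ⟨e⟩, hr⟩
    have h' : (G'.comap f.toHom).map f.toHom = G' := by
      ext x y
      · simp only [Subgraph.map_verts, Subgraph.comap_verts, Set.mem_image, Set.mem_preimage]
        constructor
        · rintro ⟨a, ha, rfl⟩
          exact ha
        · intro hx
          obtain ⟨a, rfl⟩ := hr hx
          exact ⟨a, hx, rfl⟩
      · simp only [Subgraph.map_adj, Relation.map_apply, Subgraph.comap_adj]
        constructor
        · rintro ⟨a, b, ⟨-, h⟩, rfl, rfl⟩
          exact h
        · intro h
          obtain ⟨a, rfl⟩ := hr h.fst_mem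
          obtain ⟨b, rfl⟩ := hr h.snd_mem
          exact ⟨a, b, ⟨f.map_adj_iff.1 h.adj_sub, h⟩, rfl, rfl⟩
    refine ⟨⟨G'.comap f.toHom,
      ⟨(f.toCopy.isoSubgraphMap (G'.comap f.toHom)).trans ?_⟩⟩, Subtype.ext h'⟩
    change (Subgraph.map f.toHom (G'.comap f.toHom)).coe ≃g F
    rw [h']
    exact e

/-- Double counting of the pairs formed by a subgraph of `G` isomorphic to `F` and a `k`-element
set of vertices containing it. -/
lemma card_subgraph_iso_mul_choose {V U : Type*} [Fintype V] [Fintype U] [DecidableEq V]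
    (G : SimpleGraph V) (F : SimpleGraph U) {k : ℕ} (hF : Fintype.card U ≤ k) :
    Nat.card {G' : G.Subgraph // Nonempty (G'.coe ≃g F)} *
        (Fintype.card V - Fintype.card U).choose (k - Fintype.card U) =
      ∑ s : {s : Finset V // s.card = k},
        Nat.card {G' : G.Subgraph // Nonempty (G'.coe ≃g F) ∧ G'.verts ⊆ (s.1 : Set V)} := by
  classical
  have hsup (G' : {G' : G.Subgraph // Nonempty (G'.coe ≃g F)}) :
      Nat.card {s : {s : Finset V // s.card = k} // G'.1.verts ⊆ (s.1 : Set V)} =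
        (Fintype.card V - Fintype.card U).choose (k - Fintype.card U) := by
    have h : Nat.card G'.1.verts = Fintype.card U := by
      rw [← Nat.card_eq_fintype_card]
      exact Nat.card_congr G'.2.some.toEquiv
    rw [card_supersets_of_card_eq _ (h ▸ hF), h]
  let e : (Σ G' : {G' : G.Subgraph // Nonempty (G'.coe ≃g F)},
        {s : {s : Finset V // s.card = k} // G'.1.verts ⊆ (s.1 : Set V)}) ≃
      Σ s : {s : Finset V // s.card = k},
        {G' : G.Subgraph // Nonempty (G'.coe ≃g F) ∧ G'.verts ⊆ (s.1 : Set V)} :=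
    { toFun := fun p ↦ ⟨p.2.1, p.1.1, p.1.2, p.2.2⟩
      invFun := fun p ↦ ⟨⟨p.2.1, p.2.2.1⟩, p.1, p.2.2.2⟩
      left_inv := fun _ ↦ rfl
      right_inv := fun _ ↦ rfl }
  have := Fintype.ofFinite {G' : G.Subgraph // Nonempty (G'.coe ≃g F)}
  rw [← Nat.card_sigma, ← Nat.card_congr e, Nat.card_sigma]
  simp only [hsup, Finset.sum_const, Finset.card_univ, Nat.card_eq_fintype_card, smul_eq_mul]

end SimpleGraph

/-- Kelly's Lemma: if `G` and `H` have the same `k`-deck, then for every graph `F` with at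
most `k` vertices, `G` and `H` contain the same number of subgraphs isomorphic to `F`. -/
theorem kelly_lemma
    {V W U : Type*} [Fintype V] [Fintype W] [Fintype U]
    [DecidableEq V] [DecidableEq W]
    (G : SimpleGraph V) (H : SimpleGraph W) (k : ℕ)
    (hcard : Fintype.card V = Fintype.card W)
    (hk1 : 1 ≤ k) (hkn : k ≤ Fintype.card V)
    (hdeck : SameDeck G H k)
    (F : SimpleGraph U) (hF : Fintype.card U ≤ k) :
    Nat.card {G' : G.Subgraph // Nonempty (G'.coe ≃g F)} =
      Nat.card {H' : H.Subgraph // Nonempty (H'.coe ≃g F)} := by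
  obtain ⟨e, he⟩ := hdeck
  refine Nat.eq_of_mul_eq_mul_right (Nat.choose_pos (Nat.sub_le_sub_right hkn (Fintype.card U))) ?_
  rw [card_subgraph_iso_mul_choose G F hF, hcard, card_subgraph_iso_mul_choose H F hF,
    ← e.sum_comp]
  refine Finset.sum_congr rfl fun s _ ↦ ?_
  obtain ⟨φ⟩ := he s
  have hG := card_subgraph_iso_eq_of_embedding F (Embedding.induce (G := G) (s.1 : Set V))
  have hH := card_subgraph_iso_eq_of_embedding F
    ((Embedding.induce (G := H) ((e s).1 : Set W)).comp φ.toEmbedding)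
  have hr : Set.range ((Embedding.induce (G := H) ((e s).1 : Set W)).comp φ.toEmbedding) =
      ((e s).1 : Set W) := by
    rw [Embedding.coe_comp]
    exact (φ.surjective.range_comp _).trans Subtype.range_coe
  have hr' : Set.range (Embedding.induce (G := G) (s.1 : Set V)) = (s.1 : Set V) :=
    Subtype.range_coe
  rw [hr'] at hG
  rw [hr] at hH
  exact hG.symm.trans hH
end

section
/- Let G and H be finite 3-regular simple graphs on the same number n of vertices, with n ≥ 10, having the same (n−2)-deck. Then G and H have the same (finite) girth g, the same number of cycles of length g, and the same number of cycles of length g+1. -/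
open SimpleGraph

/-- The number of cycles of length `m` in `G`, where two cycles are counted as distinct
exactly when their edge sets differ. -/
noncomputable def cycleCount {V : Type*} (G : SimpleGraph V) (m : ℕ) : ℕ :=
  Nat.card {s : Set (Sym2 V) //
    ∃ (v : V) (c : G.Walk v v), c.IsCycle ∧ c.length = m ∧ s = {e | e ∈ c.edges}}

/-- The edge sets of the cycles of length `m` in `G`. -/
def cycleEdgeSets {V : Type*} (G : SimpleGraph V) (m : ℕ) : Set (Set (Sym2 V)) :=
  {s | ∃ (v : V) (c : G.Walk v v), c.IsCycle ∧ c.length = m ∧ s = {e | e ∈ c.edges}}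

/-- The vertices covered by a set of edges. -/
def coveredVerts {V : Type*} (E : Set (Sym2 V)) : Set V :=
  {v | ∃ e ∈ E, v ∈ e}

theorem cycleCount_eq_ncard {V : Type*} (G : SimpleGraph V) (m : ℕ) :
    cycleCount G m = (cycleEdgeSets G m).ncard :=
  Nat.card_coe_set_eq (cycleEdgeSets G m)

theorem coveredVerts_edges {V : Type*} {G : SimpleGraph V} {v : V} {c : G.Walk v v}
    (hc : c.IsCycle) : coveredVerts {e | e ∈ c.edges} = {w | w ∈ c.support} := by
  ext w
  exact (Walk.mem_support_iff_exists_mem_edges_of_not_nil hc.not_nil).symm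

theorem ncard_coveredVerts {V : Type*} [DecidableEq V] {G : SimpleGraph V} {m : ℕ}
    {E : Set (Sym2 V)} (hE : E ∈ cycleEdgeSets G m) : (coveredVerts E).ncard = m := by
  obtain ⟨v, c, hc, rfl, rfl⟩ := hE
  have h : {w | w ∈ c.support} = (c.support.tail.toFinset : Set V) := by
    ext w
    simp only [Set.mem_ofPred_eq, List.coe_toFinset]
    rw [Walk.mem_support_iff]
    refine or_iff_right_of_imp ?_
    rintro rfl
    exact Walk.end_mem_tail_support hc.not_nil
  rw [coveredVerts_edges hc, h, Set.ncard_coe_finset, List.toFinset_card_of_nodup hc.support_nodup]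
  simp

theorem image_mem_cycleEdgeSets {V W : Type*} {G : SimpleGraph V} {H : SimpleGraph W}
    (f : G →g H) (hf : Function.Injective f) {m : ℕ} {E : Set (Sym2 V)}
    (hE : E ∈ cycleEdgeSets G m) : Sym2.map f '' E ∈ cycleEdgeSets H m := by
  obtain ⟨v, c, hc, rfl, rfl⟩ := hE
  refine ⟨f v, c.map f, hc.map hf, by simp, ?_⟩
  ext e
  simp [Walk.edges_map]

theorem cycleCount_le_of_injective_hom {V W : Type*} [Finite W] {G : SimpleGraph V}
    {H : SimpleGraph W} (f : G →g H) (hf : Function.Injective f) (m : ℕ) :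
    cycleCount G m ≤ cycleCount H m := by
  rw [cycleCount_eq_ncard, cycleCount_eq_ncard,
    ← Set.ncard_image_of_injective (cycleEdgeSets G m) (Sym2.map.injective hf).image_injective]
  refine Set.ncard_le_ncard ?_ (Set.toFinite _)
  rintro _ ⟨E, hE, rfl⟩
  exact image_mem_cycleEdgeSets f hf hE

theorem cycleCount_congr {V W : Type*} [Finite V] [Finite W] {G : SimpleGraph V}
    {H : SimpleGraph W} (f : G ≃g H) (m : ℕ) : cycleCount G m = cycleCount H m :=
  (cycleCount_le_of_injective_hom f.toHom f.injective m).antisymm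
    (cycleCount_le_of_injective_hom f.symm.toHom f.symm.injective m)

theorem cycleCount_induce {V : Type*} (G : SimpleGraph V) (s : Set V) (m : ℕ) :
    cycleCount (G.induce s) m = {E ∈ cycleEdgeSets G m | coveredVerts E ⊆ s}.ncard := by
  have hinj : Function.Injective (Embedding.induce (G := G) s).toHom :=
    (Embedding.induce (G := G) s).injective
  rw [cycleCount_eq_ncard,
    ← Set.ncard_image_of_injective (cycleEdgeSets (G.induce s) m)
      (Sym2.map.injective hinj).image_injective]
  congr 1
  ext E
  constructor
  · rintro ⟨E, hE, rfl⟩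
    refine ⟨image_mem_cycleEdgeSets _ hinj hE, ?_⟩
    rintro v ⟨_, ⟨e, -, rfl⟩, hv⟩
    obtain ⟨w, -, rfl⟩ := Sym2.mem_map.mp hv
    exact w.2
  · rintro ⟨⟨v, c, hc, rfl, rfl⟩, hs⟩
    rw [coveredVerts_edges hc] at hs
    have hmap := c.map_induce hs
    refine ⟨{e | e ∈ (c.induce s hs).edges}, ⟨_, c.induce s hs, ?_, ?_, rfl⟩, ?_⟩
    · rw [← Walk.isCycle_map_iff_of_injective hinj, hmap]
      exact hc
    · rw [← Walk.length_map (Embedding.induce (G := G) s).toHom, hmap]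
      rfl
    · ext e
      have hedges := (Walk.edges_map _ _).symm.trans (congrArg Walk.edges hmap)
      exact List.mem_map.symm.trans (by rw [hedges]; rfl)

theorem card_supersets {V : Type*} [Fintype V] [DecidableEq V] (t : Finset V) {k : ℕ}
    (hk : t.card ≤ k) :
    ((Finset.powersetCard k Finset.univ).filter (t ⊆ ·)).card =
      (Fintype.card V - t.card).choose (k - t.card) := by
  rw [← Finset.card_compl, ← Finset.card_powersetCard]
  refine Finset.card_bij' (fun s _ => s \ t) (fun s _ => s ∪ t) ?_ ?_ ?_ ?_
  · intro s hs
    simp only [Finset.mem_filter, Finset.mem_powersetCard] at hs ⊢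
    refine ⟨fun x hx => by simpa using (Finset.mem_sdiff.mp hx).2, ?_⟩
    rw [Finset.card_sdiff_of_subset hs.2, hs.1.2]
  · intro s hs
    simp only [Finset.mem_filter, Finset.mem_powersetCard] at hs ⊢
    have hd : Disjoint s t := Finset.subset_compl_iff_disjoint_right.mp hs.1
    refine ⟨⟨Finset.subset_univ _, ?_⟩, Finset.subset_union_right⟩
    rw [Finset.card_union_of_disjoint hd, hs.2]
    omega
  · intro s hs
    exact Finset.sdiff_union_of_subset (Finset.mem_filter.mp hs).2
  · intro s hs
    exact Finset.union_sdiff_cancel_right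
      (Finset.subset_compl_iff_disjoint_right.mp (Finset.mem_powersetCard.mp hs).1)

/-- Kelly's counting lemma for cycles. -/
theorem sum_cycleCount_induce {V : Type*} [Fintype V] [DecidableEq V] (G : SimpleGraph V)
    {k m : ℕ} (hm : m ≤ k) :
    ∑ s ∈ Finset.powersetCard k (Finset.univ : Finset V), cycleCount (G.induce (s : Set V)) m =
      cycleCount G m * (Fintype.card V - m).choose (k - m) := by
  classical
  have hfin : (cycleEdgeSets G m).Finite := Set.toFinite _
  have hleft : ∀ s : Finset V, cycleCount (G.induce (s : Set V)) m =
      (hfin.toFinset.bipartiteAbove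
        (fun (s : Finset V) E => coveredVerts E ⊆ (s : Set V)) s).card := by
    intro s
    rw [cycleCount_induce, ← Set.ncard_coe_finset]
    congr 1
    ext E
    simp
  have hright : ∀ E ∈ hfin.toFinset, ((Finset.powersetCard k Finset.univ).bipartiteBelow
      (fun (s : Finset V) E => coveredVerts E ⊆ (s : Set V)) E).card =
        (Fintype.card V - m).choose (k - m) := by
    intro E hE
    have hcard := ncard_coveredVerts (hfin.mem_toFinset.mp hE)
    rw [Set.ncard_eq_toFinset_card'] at hcard
    rw [← hcard] at hm
    rw [← hcard, ← card_supersets _ hm]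
    congr 1
    ext s
    simp only [Finset.mem_bipartiteBelow, Finset.mem_filter, Set.toFinset_subset]
  rw [Finset.sum_congr rfl fun s _ => hleft s,
    Finset.sum_card_bipartiteAbove_eq_sum_card_bipartiteBelow, Finset.sum_congr rfl hright,
    Finset.sum_const, smul_eq_mul, cycleCount_eq_ncard, Set.ncard_eq_toFinset_card _ hfin]

theorem SameDeck.cycleCount_eq {V W : Type*} [Fintype V] [Fintype W] [DecidableEq V]
    [DecidableEq W] {G : SimpleGraph V} {H : SimpleGraph W} {k m : ℕ} (h : SameDeck G H k)
    (hcard : Fintype.card V = Fintype.card W) (hk : k ≤ Fintype.card V) (hm : m ≤ k) :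
    cycleCount G m = cycleCount H m := by
  obtain ⟨e, he⟩ := h
  have hpos : 0 < (Fintype.card V - m).choose (k - m) := Nat.choose_pos (by omega)
  refine Nat.eq_of_mul_eq_mul_right hpos ?_
  rw [← sum_cycleCount_induce G hm, hcard, ← sum_cycleCount_induce H hm,
    Finset.sum_subtype (p := fun s : Finset V => s.card = k) _ (by simp),
    Finset.sum_subtype (p := fun s : Finset W => s.card = k) _ (by simp)]
  exact Fintype.sum_equiv e _ _ fun s => cycleCount_congr (he s).some m

theorem cycleCount_pos_iff {V : Type*} [Finite V] {G : SimpleGraph V} {m : ℕ} :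
    0 < cycleCount G m ↔ ∃ (v : V) (c : G.Walk v v), c.IsCycle ∧ c.length = m := by
  rw [cycleCount_eq_ncard, Set.ncard_pos (Set.toFinite _)]
  constructor
  · rintro ⟨E, v, c, hc, hm, -⟩
    exact ⟨v, c, hc, hm⟩
  · rintro ⟨v, c, hc, hm⟩
    exact ⟨_, v, c, hc, hm, rfl⟩

theorem SimpleGraph.IsAcyclic.card_edgeFinset_lt {V : Type*} [Fintype V] [Nonempty V]
    {G : SimpleGraph V} [Fintype G.edgeSet] (h : G.IsAcyclic) :
    G.edgeFinset.card < Fintype.card V := by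
  classical
  obtain ⟨T, hGT, -, hT⟩ := connected_top.exists_isTree_le_of_le_of_isAcyclic le_top h
  rw [← hT.card_edgeFinset, Nat.lt_succ_iff]
  exact Finset.card_le_card (edgeFinset_mono hGT)

/-- A cubic graph on `n ≥ 10` vertices has girth at most `n - 3`. -/
theorem SimpleGraph.IsRegularOfDegree.exists_isCycle_length_le {V : Type*} [Fintype V]
    [DecidableEq V] {G : SimpleGraph V} [DecidableRel G.Adj] (hG : G.IsRegularOfDegree 3)
    (hn : 10 ≤ Fintype.card V) :
    ∃ (v : V) (c : G.Walk v v), c.IsCycle ∧ c.length + 3 ≤ Fintype.card V := by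
  obtain ⟨a⟩ : Nonempty V := Fintype.card_pos_iff.mp (by omega)
  obtain ⟨b, hab⟩ := (G.degree_pos_iff_exists_adj a).mp (by rw [hG a]; norm_num)
  obtain ⟨c, hc⟩ : ∃ c, c ∉ ({a, b} : Finset V) := by
    by_contra! hall
    have := Finset.card_le_card fun x (_ : x ∈ Finset.univ) => hall x
    rw [Finset.card_univ] at this
    have := Finset.card_le_two (a := a) (b := b)
    omega
  simp only [Finset.mem_insert, Finset.mem_singleton, not_or] at hc
  have htriple : ({a, b, c} : Finset V).card = 3 :=
    Finset.card_eq_three.mpr ⟨a, b, c, hab.ne, Ne.symm hc.1, Ne.symm hc.2, rfl⟩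
  let S : Finset V := {a, b, c}ᶜ
  have hS : S.card + 3 = Fintype.card V := by
    rw [← htriple, Finset.card_compl_add_card]
  have hcardS : Fintype.card (S : Set V) = S.card := by simp
  have : Nonempty (S : Set V) := Fintype.card_pos_iff.mp (by omega)
  have hedges : 2 * G.edgeFinset.card = 3 * Fintype.card V := by
    rw [← G.sum_degrees_eq_twice_card_edges, Finset.sum_congr rfl fun v _ => hG v]
    simp [mul_comm]
  have hinc (v : V) : (G.incidenceFinset v).card = 3 := by
    rw [G.card_incidenceFinset_eq_degree, hG v]
  have hpair : (G.incidenceFinset a ∪ G.incidenceFinset b).card ≤ 5 := by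
    have hpos : 0 < (G.incidenceFinset a ∩ G.incidenceFinset b).card :=
      Finset.card_pos.mpr ⟨s(a, b), by simp [incidenceSet, hab]⟩
    have := Finset.card_union_add_card_inter (G.incidenceFinset a) (G.incidenceFinset b)
    rw [hinc, hinc] at this
    omega
  have hdel := (Finset.card_union_le (G.incidenceFinset a ∪ G.incidenceFinset b)
    (G.incidenceFinset c)).trans (Nat.add_le_add hpair (hinc c).le)
  have hinduce : G.edgeFinset.card ≤ (G.induce (S : Set V)).edgeFinset.card + 8 := by
    rw [← card_filter_edgeFinset_toFinset_subset, filter_edgeFinset_toFinset_subset]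
    refine le_trans (Finset.card_le_card ?_)
      ((Finset.card_union_le _ _).trans (Nat.add_le_add_left hdel _))
    intro e he
    by_cases h : a ∈ e ∨ b ∈ e ∨ c ∈ e
    · have hmem := mem_edgeFinset.mp he
      simp only [Finset.mem_union, mem_incidenceFinset, incidenceSet, Set.mem_sep_iff, hmem,
        true_and]
      tauto
    · refine Finset.mem_union_left _ (Finset.mem_inter.mpr ⟨he, ?_⟩)
      rw [Finset.mem_sym2_iff]
      intro x hx
      simp only [S, Finset.mem_compl, Finset.mem_insert,
        Finset.mem_singleton]
      rintro (rfl | rfl | rfl) <;> tauto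
  have hcyc : ¬ (G.induce (S : Set V)).IsAcyclic := fun hac => by
    have := hac.card_edgeFinset_lt
    omega
  unfold SimpleGraph.IsAcyclic at hcyc
  push Not at hcyc
  obtain ⟨v, w, hw⟩ := hcyc
  have hlen := hw.support_nodup.length_le_card
  simp only [List.length_tail, Walk.length_support] at hlen
  refine ⟨_, w.map (Embedding.induce (S : Set V)).toHom,
    hw.map (Embedding.induce (G := G) (S : Set V)).injective, ?_⟩
  rw [Walk.length_map]
  omega

theorem egirth_eq_of_cycleCount_eq {V W : Type*} [Finite V] [Finite W] {G : SimpleGraph V}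
    {H : SimpleGraph W} {g : ℕ} (hg : G.egirth = g)
    (hcount : ∀ m ≤ g, cycleCount G m = cycleCount H m) : H.egirth = g := by
  refine le_antisymm ?_ (le_egirth.mpr fun v c hc => ?_)
  · have hac : ¬ G.IsAcyclic := by simp [← egirth_eq_top, hg]
    obtain ⟨v, c, hc, hlen⟩ := exists_egirth_eq_length.mpr hac
    rw [hg, Nat.cast_inj] at hlen
    have hpos := cycleCount_pos_iff.mpr ⟨v, c, hc, hlen.symm⟩
    rw [hcount g le_rfl] at hpos
    obtain ⟨w, d, hd, rfl⟩ := cycleCount_pos_iff.mp hpos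
    exact egirth_le_length hd
  · by_contra! hlt
    have hlt' : c.length < g := by exact_mod_cast hlt
    have hpos := cycleCount_pos_iff.mpr ⟨v, c, hc, rfl⟩
    rw [← hcount _ hlt'.le] at hpos
    obtain ⟨w, d, hd, hlen⟩ := cycleCount_pos_iff.mp hpos
    have hle := egirth_le_length hd
    rw [hg, hlen] at hle
    exact hle.not_gt hlt

/-- Two 3-regular graphs on `n ≥ 10` vertices with the same `(n-2)`-deck have the same finite
girth `g`, the same number of `g`-cycles, and the same number of `(g+1)`-cycles. -/
theorem girth_and_short_cycle_counts_reconstructible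
    {V W : Type*} [Fintype V] [Fintype W] [DecidableEq V] [DecidableEq W]
    (G : SimpleGraph V) (H : SimpleGraph W)
    [DecidableRel G.Adj] [DecidableRel H.Adj]
    (hG : G.IsRegularOfDegree 3) (hH : H.IsRegularOfDegree 3)
    (hcard : Fintype.card V = Fintype.card W)
    (hn : 10 ≤ Fintype.card V)
    (hdeck : SameDeck G H (Fintype.card V - 2)) :
    ∃ g : ℕ, G.egirth = g ∧ H.egirth = g ∧
      cycleCount G g = cycleCount H g ∧
      cycleCount G (g + 1) = cycleCount H (g + 1) := by
  obtain ⟨v, c, hc, hlen⟩ := hG.exists_isCycle_length_le hn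
  have hcount : ∀ m ≤ Fintype.card V - 2, cycleCount G m = cycleCount H m := fun m hm =>
    hdeck.cycleCount_eq hcard (Nat.sub_le _ _) hm
  obtain ⟨g, hg⟩ := ENat.ne_top_iff_exists.mp (egirth_eq_top.not.mpr fun h => h c hc)
  have hgle : g ≤ c.length := by
    have hle := egirth_le_length hc
    rw [← hg] at hle
    exact_mod_cast hle
  exact ⟨g, hg.symm, egirth_eq_of_cycleCount_eq hg.symm fun m hm => hcount m (by omega),
    hcount g (by omega), hcount (g + 1) (by omega)⟩
end

section
/- Let G be a finite 3-regular simple graph of girth at least 5, let x ≠ y be vertices of G, and let F = G − {x,y}. If the distance between x and y in G is 1, then F has exactly four vertices of degree 2 and no vertex of degree less than 2. If the distance is 2, then F has exactly one vertex of degree 1, exactly four vertices of degree 2, and no vertex of degree 0. If the distance is greater than 2, then F has exactly six vertices of degree 2 and no vertex of degree less than 2. -/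
open SimpleGraph

/-- The degree of a vertex `z` in the graph `G − {x,y}`, i.e. its number of neighbors there. -/
noncomputable def delDeg {V : Type*} (G : SimpleGraph V) (x y : V) (z : ({x, y}ᶜ : Set V)) : ℕ :=
  ((G.induce ({x, y}ᶜ : Set V)).neighborSet z).ncard

/-- In a graph of girth at least 4, adjacent vertices have no common neighbor. -/
theorem SimpleGraph.not_adj_of_four_le_egirth {V : Type*} {G : SimpleGraph V}
    (hgirth : 4 ≤ G.egirth) {x y z : V} (hxy : G.Adj x y) (hxz : G.Adj x z) : ¬ G.Adj y z := by
  intro hyz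
  have hcycle : (Walk.cons hxy (Walk.cons hyz (Walk.cons hxz.symm Walk.nil))).IsCycle := by
    have h₁ := hxy.ne
    have h₂ := hxz.ne
    have h₃ := hyz.ne
    simp [Walk.isCycle_def, Walk.isTrail_def]
    grind
  have h := le_egirth.mp hgirth x _ hcycle
  norm_num at h

/-- In a graph of girth at least 5, two distinct vertices have at most one common neighbor. -/
theorem SimpleGraph.eq_of_adj_of_five_le_egirth {V : Type*} {G : SimpleGraph V}
    (hgirth : 5 ≤ G.egirth) {x y z w : V} (hne : x ≠ y) (hxz : G.Adj x z) (hyz : G.Adj y z)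
    (hxw : G.Adj x w) (hyw : G.Adj y w) : z = w := by
  by_contra hzw
  have hcycle : (Walk.cons hxz (Walk.cons hyz.symm
      (Walk.cons hyw (Walk.cons hxw.symm Walk.nil)))).IsCycle := by
    have h₁ := hxz.ne
    have h₂ := hyz.ne
    have h₃ := hxw.ne
    have h₄ := hyw.ne
    simp [Walk.isCycle_def, Walk.isTrail_def]
    grind
  have h := le_egirth.mp hgirth x _ hcycle
  norm_num at h

theorem delDeg_eq_card {V : Type*} [Fintype V] [DecidableEq V] (G : SimpleGraph V)
    [DecidableRel G.Adj] (x y : V) (z : ({x, y}ᶜ : Set V)) :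
    delDeg G x y z = (G.neighborFinset z \ {x, y}).card := by
  rw [delDeg, ← Set.ncard_image_of_injective _ Subtype.val_injective, ← Set.ncard_coe_finset]
  congr 1
  ext v
  simp

/-- In a cubic graph, removing `x` and `y` lowers a degree by the number of neighbors among them. -/
theorem delDeg_add {V : Type*} [Fintype V] [DecidableEq V] (G : SimpleGraph V)
    [DecidableRel G.Adj] (hG : G.IsRegularOfDegree 3) {x y : V} (hne : x ≠ y)
    (z : ({x, y}ᶜ : Set V)) :
    delDeg G x y z + ((if G.Adj x z then 1 else 0) + (if G.Adj y z then 1 else 0)) = 3 := by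
  have h := Finset.card_sdiff_add_card_inter (G.neighborFinset z) {x, y}
  have hinter : (G.neighborFinset z ∩ {x, y}).card =
      (if G.Adj x z then 1 else 0) + (if G.Adj y z then 1 else 0) := by
    rw [Finset.inter_comm, ← Finset.filter_mem_eq_inter, Finset.card_filter,
      Finset.sum_pair hne]
    simp [G.adj_comm]
  rw [delDeg_eq_card, ← hinter, h, card_neighborFinset_eq_degree, hG]

/-- The vertices of degree 1 in `G − {x,y}` are the common neighbors of `x` and `y`. -/
theorem ncard_delDeg_eq_one {V : Type*} [Fintype V] [DecidableEq V] (G : SimpleGraph V)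
    [DecidableRel G.Adj] (hG : G.IsRegularOfDegree 3) {x y : V} (hne : x ≠ y) :
    {z : ({x, y}ᶜ : Set V) | delDeg G x y z = 1}.ncard =
      (G.neighborFinset x ∩ G.neighborFinset y).card := by
  rw [← Set.ncard_image_of_injective _ Subtype.val_injective, ← Set.ncard_coe_finset]
  congr 1
  ext v
  have hx := G.irrefl (v := x)
  have hy := G.irrefl (v := y)
  by_cases hv : v = x ∨ v = y
  · simp
    grind
  · have h := delDeg_add G hG hne ⟨v, by simpa using hv⟩
    rw [not_or] at hv
    simp [hv]
    grind

theorem ncard_delDeg_eq_two {V : Type*} [Fintype V] [DecidableEq V] (G : SimpleGraph V)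
    [DecidableRel G.Adj] (hG : G.IsRegularOfDegree 3) {x y : V} (hne : x ≠ y) :
    {z : ({x, y}ᶜ : Set V) | delDeg G x y z = 2}.ncard +
      2 * (G.neighborFinset x ∩ G.neighborFinset y).card + (if G.Adj x y then 2 else 0) = 6 := by
  have hset : {z : ({x, y}ᶜ : Set V) | delDeg G x y z = 2}.ncard =
      (((G.neighborFinset x \ G.neighborFinset y).erase y) ∪
        ((G.neighborFinset y \ G.neighborFinset x).erase x)).card := by
    rw [← Set.ncard_image_of_injective _ Subtype.val_injective, ← Set.ncard_coe_finset]
    congr 1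
    ext v
    have hx := G.irrefl (v := x)
    have hy := G.irrefl (v := y)
    by_cases hv : v = x ∨ v = y
    · simp
      grind
    · have h := delDeg_add G hG hne ⟨v, by simpa using hv⟩
      rw [not_or] at hv
      simp [hv]
      grind
  have hdisj : Disjoint ((G.neighborFinset x \ G.neighborFinset y).erase y)
      ((G.neighborFinset y \ G.neighborFinset x).erase x) := by
    rw [Finset.disjoint_left]
    grind
  have hx := Finset.card_sdiff_add_card_inter (G.neighborFinset x) (G.neighborFinset y)
  have hy := Finset.card_sdiff_add_card_inter (G.neighborFinset y) (G.neighborFinset x)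
  rw [card_neighborFinset_eq_degree, hG] at hx hy
  rw [Finset.inter_comm] at hy
  rw [hset, Finset.card_union_of_disjoint hdisj, Finset.card_erase_eq_ite,
    Finset.card_erase_eq_ite]
  by_cases hxy : G.Adj x y
  · have hpos₁ : 0 < (G.neighborFinset x \ G.neighborFinset y).card :=
      Finset.card_pos.mpr ⟨y, by simp [hxy]⟩
    have hpos₂ : 0 < (G.neighborFinset y \ G.neighborFinset x).card :=
      Finset.card_pos.mpr ⟨x, by simp [hxy.symm]⟩
    simp [hxy, hxy.symm]
    omega
  · simp [hxy, G.adj_comm y x]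
    omega

/-- Degree statistics of the card `G − {x,y}` of a 3-regular graph of girth at least 5,
according to whether `x` and `y` are at distance 1, at distance 2, or at distance
greater than 2 (every `x,y`-walk has length greater than 2). -/
theorem card_degree_statistics {V : Type*} [Fintype V] [DecidableEq V]
    (G : SimpleGraph V) [DecidableRel G.Adj]
    (hG : G.IsRegularOfDegree 3) (hgirth : 5 ≤ G.egirth)
    (x y : V) (hne : x ≠ y) :
    (G.dist x y = 1 →
      {z : ({x, y}ᶜ : Set V) | delDeg G x y z = 2}.ncard = 4 ∧
      ∀ z : ({x, y}ᶜ : Set V), ¬ delDeg G x y z < 2) ∧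
    (G.dist x y = 2 →
      {z : ({x, y}ᶜ : Set V) | delDeg G x y z = 1}.ncard = 1 ∧
      {z : ({x, y}ᶜ : Set V) | delDeg G x y z = 2}.ncard = 4 ∧
      ∀ z : ({x, y}ᶜ : Set V), delDeg G x y z ≠ 0) ∧
    ((∀ p : G.Walk x y, 2 < p.length) →
      {z : ({x, y}ᶜ : Set V) | delDeg G x y z = 2}.ncard = 6 ∧
      ∀ z : ({x, y}ᶜ : Set V), ¬ delDeg G x y z < 2) := by
  have hone := ncard_delDeg_eq_one G hG hne
  have htwo := ncard_delDeg_eq_two G hG hne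
  have hadd := delDeg_add G hG hne
  have hcommon : (∀ z, G.Adj x z → ¬ G.Adj y z) →
      (G.neighborFinset x ∩ G.neighborFinset y).card = 0 ∧
      ∀ z : ({x, y}ᶜ : Set V), ¬ delDeg G x y z < 2 := by
    refine fun h ↦ ⟨?_, fun z hz ↦ ?_⟩
    · rw [Finset.card_eq_zero, Finset.eq_empty_iff_forall_notMem]
      simpa using h
    · have := hadd z
      have := h z
      grind
  refine ⟨fun hdist ↦ ?_, fun hdist ↦ ?_, fun hwalk ↦ ?_⟩
  · have hxy := dist_eq_one_iff_adj.mp hdist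
    obtain ⟨hcard, hmin⟩ := hcommon fun z hxz ↦
      not_adj_of_four_le_egirth (le_trans (by norm_num) hgirth) hxy hxz
    refine ⟨?_, hmin⟩
    simp only [hxy, if_true] at htwo
    omega
  · have hxy : ¬ G.Adj x y := fun h ↦ by simp [dist_eq_one_iff_adj.mpr h] at hdist
    obtain ⟨p, hp⟩ := exists_walk_of_dist_ne_zero (G := G) (u := x) (v := y) (by omega)
    rw [hdist] at hp
    obtain ⟨w, hxw, hyw⟩ : ∃ w, G.Adj x w ∧ G.Adj y w :=
      ⟨p.getVert 1, by simpa using p.adj_getVert_succ (i := 0) (by omega), by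
        have h := p.adj_getVert_succ (i := 1) (by omega)
        rw [show 1 + 1 = p.length by omega, p.getVert_length] at h
        exact h.symm⟩
    have hcard : (G.neighborFinset x ∩ G.neighborFinset y).card = 1 := by
      refine Finset.card_eq_one.mpr ⟨w, Finset.eq_singleton_iff_unique_mem.mpr ⟨?_, ?_⟩⟩
      · simp [hxw, hyw]
      · intro z hz
        simp only [Finset.mem_inter, mem_neighborFinset] at hz
        exact eq_of_adj_of_five_le_egirth hgirth hne hz.1 hz.2 hxw hyw
    simp only [hxy, if_false] at htwo
    refine ⟨by omega, by omega, fun z hz ↦ ?_⟩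
    have := hadd z
    grind
  · have hxy : ¬ G.Adj x y := fun h ↦ by simpa using hwalk h.toWalk
    obtain ⟨hcard, hmin⟩ := hcommon fun z hxz hyz ↦ by
      simpa using hwalk (Walk.cons hxz hyz.symm.toWalk)
    refine ⟨?_, hmin⟩
    simp only [hxy, if_false] at htwo
    omega
end
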